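/- arXiv:1811.10926 — 8 statements merged into one kernel-verified Lean document; each statement's English description precedes it below -/
import Mathlib

section
/- The C₂ cluster ideal I_{C₂} is a prime ideal of R₁₃; equivalently, the C₂ cluster variety X_{C₂} ⊆ ℂ¹³ is irreducible and its coordinate ring R₁₃/I_{C₂} is an integral domain. -/
/-!
The C₂ cluster variety.

`R13` is the polynomial ring over ℂ in the 13 variables, indexed as follows:
`0 ↦ θ₁, 1 ↦ θ₁₂, 2 ↦ θ₂, 3 ↦ θ₂₃, 4 ↦ θ₃, 5 ↦ θ₃₁,
 6 ↦ A₁, 7 ↦ A₁₂, 8 ↦ A₂, 9 ↦ A₂₃, 10 ↦ A₃, 11 ↦ A₃₁, 12 ↦ λ`.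
Indices `i : Fin 3` stand for the (cyclic) indices 1,2,3, with `Fin 3` addition.
-/

open MvPolynomial

noncomputable section

abbrev R13 : Type := MvPolynomial (Fin 13) ℂ

/-- The cluster variables θ₁, θ₂, θ₃. -/
def th : Fin 3 → R13 := ![X 0, X 2, X 4]

/-- The cluster variables θ₁₂, θ₂₃, θ₃₁ : `thp i = θ_{i,i+1}`. -/
def thp : Fin 3 → R13 := ![X 1, X 3, X 5]

/-- The coefficients A₁, A₂, A₃. -/
def aS : Fin 3 → R13 := ![X 6, X 8, X 10]

/-- The coefficients A₁₂, A₂₃, A₃₁ : `aP i = A_{i,i+1}`. -/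
def aP : Fin 3 → R13 := ![X 7, X 9, X 11]

/-- `A_{xy}` for *distinct* `x y : Fin 3` (unordered pair: `A_{xy} = A_{yx}`). -/
def aPP (x y : Fin 3) : R13 := aP (1 - x - y)

/-- The parameter λ. -/
def lam : R13 := X 12

/-- First family of relations: `θᵢθⱼ − A_{ij}θ_{ij} − A_{jk}A_kA_{ki}`,
for `(i,j,k)` a cyclic permutation of `(1,2,3)`. -/
def g1 (i : Fin 3) : R13 :=
  th i * th (i + 1) - aP i * thp i - aP (i + 1) * aS (i + 2) * aP (i + 2)

/-- Second family of relations: `θ_{ki}θ_{ij} − A_iθᵢ² − λA_{jk}θᵢ − A_jA_{jk}²A_k`. -/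
def g2 (i : Fin 3) : R13 :=
  thp (i + 2) * thp i - aS i * th i ^ 2 - lam * aP (i + 1) * th i
    - aS (i + 1) * aP (i + 1) ^ 2 * aS (i + 2)

/-- Third family of relations: `θᵢθ_{jk} − A_{ij}A_jθⱼ − λA_{ki}A_{ij} − A_kA_{ki}θ_k`. -/
def g3 (i : Fin 3) : R13 :=
  th i * thp (i + 1) - aP i * aS (i + 1) * th (i + 1) - lam * aP (i + 2) * aP i
    - aS (i + 2) * aP (i + 2) * th (i + 2)

/-- The C₂ cluster ideal, generated by the nine relations. -/
def IC2 : Ideal R13 :=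
  Ideal.span (Set.range g1 ∪ Set.range g2 ∪ Set.range g3)

/-- The nine generators of `IC2`, as a doubly-indexed family. -/
def genC2 : Fin 3 → Fin 3 → R13 := ![g1, g2, g3]

/-- The C₂ cluster variety `X_{C₂} ⊆ ℂ¹³`: the common zero locus of the nine generators. -/
def XC2 : Set (Fin 13 → ℂ) :=
  {p | ∀ i : Fin 3, eval p (g1 i) = 0 ∧ eval p (g2 i) = 0 ∧ eval p (g3 i) = 0}

/-- The condition that all six cluster coordinates θ vanish at `p`. -/
def thZero (p : Fin 13 → ℂ) : Prop :=
  ∀ i : Fin 3, eval p (th i) = 0 ∧ eval p (thp i) = 0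

end

/-- If modulo an ideal `J` every nonstandard monomial is divisible by a monomial that reduces
to terms of smaller weight, then the standard monomials span modulo `J`. -/
theorem restrictSupport_sup_eq_top_of_reduction {σ R : Type*} [CommRing R] (w : σ → ℕ)
    (S : Set (σ →₀ ℕ)) (J : Ideal (MvPolynomial σ R))
    (h : ∀ e ∉ S, ∃ m ≤ e, ∃ q ∈ restrictSupport R {u | Finsupp.weight w u < Finsupp.weight w m},
      monomial m 1 - q ∈ J) :
    restrictSupport R S ⊔ J.restrictScalars R = ⊤ := by
  set N := restrictSupport R S ⊔ J.restrictScalars R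
  have key : ∀ n : ℕ, ∀ e : σ →₀ ℕ, Finsupp.weight w e = n → monomial e (1 : R) ∈ N := by
    intro n
    induction n using Nat.strong_induction_on with
    | _ n ih =>
      intro e he
      by_cases heS : e ∈ S
      · exact Submodule.mem_sup_left (by simp [monomial_mem_restrictSupport, heS])
      obtain ⟨m, hme, q, hq, hqJ⟩ := h e heS
      obtain ⟨d, rfl⟩ := exists_add_of_le hme
      have hsplit : monomial (m + d) (1 : R)
          = (monomial m 1 - q) * monomial d 1 + q * monomial d 1 := by
        rw [sub_mul, sub_add_cancel, monomial_mul, one_mul]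
      rw [hsplit]
      refine N.add_mem (Submodule.mem_sup_right (J.mul_mem_right _ hqJ)) ?_
      rw [restrictSupport_eq_span] at hq
      refine Submodule.span_induction (p := fun x _ => x * monomial d (1 : R) ∈ N) ?_ ?_ ?_ ?_ hq
      · rintro _ ⟨u, hu, rfl⟩
        rw [Set.mem_ofPred_eq] at hu
        rw [monomial_mul, one_mul]
        refine ih _ ?_ _ rfl
        rw [← he, map_add, map_add]
        omega
      · simp
      · intro x y _ _ hx hy
        rw [add_mul]
        exact N.add_mem hx hy
      · intro a x _ hx
        rw [smul_mul_assoc]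
        exact N.smul_mem a hx
  rw [eq_top_iff]
  intro p _
  rw [p.as_sum]
  refine N.sum_mem fun e _ => ?_
  rw [← mul_one (p.coeff e), ← smul_eq_mul, ← smul_monomial]
  exact N.smul_mem _ (key _ e rfl)

/-- A polynomial expression in Hahn series vanishes only trivially if the orders of the monomials
occurring in it are distinct. -/
theorem eq_zero_of_eval₂_eq_zero_of_injOn_order {σ Γ R : Type*} [Fintype σ] [AddCommMonoid Γ]
    [LinearOrder Γ] [IsOrderedCancelAddMonoid Γ] [CommRing R] [IsDomain R]
    (t : σ → HahnSeries Γ R) (ht : ∀ i, t i ≠ 0) (p : MvPolynomial σ R)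
    (hinj : Set.InjOn (fun e : σ →₀ ℕ => ∑ i, e i • (t i).order) p.support)
    (hp : eval₂ HahnSeries.C t p = 0) : p = 0 := by
  have hne : ∀ e : σ →₀ ℕ, ∏ i, t i ^ e i ≠ 0 := fun e =>
    Finset.prod_ne_zero_iff.2 fun i _ => pow_ne_zero _ (ht i)
  have hord : ∀ e : σ →₀ ℕ, (∏ i, t i ^ e i).order = ∑ i, e i • (t i).order := by
    intro e
    have : ∀ s : Finset σ, (∏ i ∈ s, t i ^ e i).order = ∑ i ∈ s, e i • (t i).order := by
      intro s
      classical
      induction s using Finset.induction_on with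
      | empty => simp
      | insert i s his ih =>
        rw [Finset.prod_insert his, Finset.sum_insert his,
          HahnSeries.order_mul (pow_ne_zero _ (ht i))
            (Finset.prod_ne_zero_iff.2 fun i _ => pow_ne_zero _ (ht i)), ih, HahnSeries.order_pow]
    exact this _
  by_contra h0
  obtain ⟨e, he, hmin⟩ := p.support.exists_min_image
    (fun e : σ →₀ ℕ => ∑ i, e i • (t i).order) (support_nonempty.2 h0)
  have hcoeff := congrArg (fun x => HahnSeries.coeff x (∑ i, e i • (t i).order)) hp
  simp only [eval₂_eq', HahnSeries.coeff_sum, HahnSeries.coeff_zero, HahnSeries.C_mul_eq_smul,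
    HahnSeries.coeff_smul] at hcoeff
  rw [Finset.sum_eq_single_of_mem e he] at hcoeff
  · rw [← hord, smul_eq_mul, mul_eq_zero, HahnSeries.coeff_order_eq_zero] at hcoeff
    exact hcoeff.elim (mem_support_iff.1 he) (hne e)
  · intro d hd hde
    rw [HahnSeries.coeff_eq_zero_of_lt_order, smul_zero]
    rw [hord]
    exact lt_of_le_of_ne (hmin d hd) fun heq => hde (hinj hd he heq.symm)

/-- The polynomial ring in the seven coefficients `A₁, A₁₂, A₂, A₂₃, A₃, A₃₁, λ`. -/
abbrev CoeffRing : Type := MvPolynomial (Fin 7) ℂ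

/-- Laurent series over `CoeffRing` in the two variables of the cluster `θ₁, θ₁₂`. -/
abbrev ClusterSeries : Type := HahnSeries (ℤ ×ₗ ℤ) CoeffRing

noncomputable section

/-- The term `r * θ₁ ^ m * θ₁₂ ^ n`. -/
def clusterTerm (m n : ℤ) (r : CoeffRing) : ClusterSeries :=
  HahnSeries.single (toLex (m, n)) r

/-- Laurent expansions of `θ₁, θ₁₂, θ₂, θ₂₃, θ₃, θ₃₁`, with the term of lowest order first. -/
def thetaSeries : Fin 6 → ClusterSeries :=
  ![clusterTerm 1 0 1,
    clusterTerm 0 1 1,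
    clusterTerm (-1) 0 (X 3 * X 4 * X 5) + clusterTerm (-1) 1 (X 1),
    clusterTerm (-2) (-1) (X 2 * X 3 ^ 2 * X 4 ^ 2 * X 5 ^ 2) +
      (clusterTerm (-2) 0 (2 * X 1 * X 2 * X 3 * X 4 * X 5) + clusterTerm (-2) 1 (X 1 ^ 2 * X 2) +
        clusterTerm (-1) 0 (X 1 * X 5 * X 6) + clusterTerm (-1) (-1) (X 3 * X 4 * X 5 ^ 2 * X 6) +
        clusterTerm 0 (-1) (X 0 * X 4 * X 5 ^ 2)),
    clusterTerm (-1) (-1) (X 2 * X 3 ^ 2 * X 4 * X 5) +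
      (clusterTerm (-1) 0 (X 1 * X 2 * X 3) + clusterTerm 0 (-1) (X 3 * X 5 * X 6) +
        clusterTerm 1 (-1) (X 0 * X 5)),
    clusterTerm 0 (-1) (X 2 * X 3 ^ 2 * X 4) +
      (clusterTerm 1 (-1) (X 3 * X 6) + clusterTerm 2 (-1) (X 0))]

/-- The exponents of the terms of lowest order of `thetaSeries`. -/
def thetaOrder : Fin 6 → ℤ × ℤ :=
  ![(1, 0), (0, 1), (-1, 0), (-2, -1), (-1, -1), (0, -1)]

theorem clusterTerm_mul (m n m' n' : ℤ) (r s : CoeffRing) :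
    clusterTerm m n r * clusterTerm m' n' s = clusterTerm (m + m') (n + n') (r * s) :=
  HahnSeries.single_mul_single

theorem clusterTerm_add (m n : ℤ) (r s : CoeffRing) :
    clusterTerm m n (r + s) = clusterTerm m n r + clusterTerm m n s :=
  map_add (HahnSeries.single.addMonoidHom _) r s

theorem C_eq_clusterTerm (r : CoeffRing) :
    (HahnSeries.C r : ClusterSeries) = clusterTerm 0 0 r := rfl

theorem lt_orderTop_add {Γ R : Type*} [LinearOrder Γ] [AddMonoid R] {g : WithTop Γ}
    {x y : HahnSeries Γ R} (hx : g < x.orderTop) (hy : g < y.orderTop) : g < (x + y).orderTop :=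
  (lt_min hx hy).trans_le HahnSeries.min_orderTop_le_orderTop_add

theorem ne_zero_and_order_clusterTerm_add {m n : ℤ} {r : CoeffRing} (hr : r ≠ 0) {y : ClusterSeries}
    (hy : (toLex (m, n) : ℤ ×ₗ ℤ) < y.orderTop) :
    clusterTerm m n r + y ≠ 0 ∧ (clusterTerm m n r + y).order = toLex (m, n) := by
  have h1 : (clusterTerm m n r).orderTop = (toLex (m, n) : ℤ ×ₗ ℤ) := HahnSeries.orderTop_single hr
  have h2 : (clusterTerm m n r + y).orderTop = (toLex (m, n) : ℤ ×ₗ ℤ) := by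
    rw [HahnSeries.orderTop_add_eq_left (by rwa [h1]), h1]
  have h3 : clusterTerm m n r + y ≠ 0 := by
    intro h
    rw [h, HahnSeries.orderTop_zero] at h2
    exact WithTop.top_ne_coe h2
  exact ⟨h3, WithTop.coe_injective ((HahnSeries.order_eq_orderTop_of_ne_zero h3).trans h2)⟩

theorem lt_orderTop_clusterTerm {m n m' n' : ℤ} (h : m < m' ∨ m = m' ∧ n < n') (r : CoeffRing) :
    ((toLex (m, n) : ℤ ×ₗ ℤ) : WithTop (ℤ ×ₗ ℤ)) < (clusterTerm m' n' r).orderTop :=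
  HahnSeries.lt_orderTop_single (Prod.Lex.toLex_lt_toLex.2 h)

theorem thetaSeries_order (i : Fin 6) :
    thetaSeries i ≠ 0 ∧ (thetaSeries i).order = toLex (thetaOrder i) := by
  fin_cases i
  · have h := ne_zero_and_order_clusterTerm_add (m := 1) (n := 0) (r := 1) one_ne_zero
      (y := 0) (by simp)
    rwa [add_zero] at h
  · have h := ne_zero_and_order_clusterTerm_add (m := 0) (n := 1) (r := 1) one_ne_zero
      (y := 0) (by simp)
    rwa [add_zero] at h
  all_goals
    refine ne_zero_and_order_clusterTerm_add (by simp [X_ne_zero]) ?_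
    repeat' apply lt_orderTop_add
    all_goals exact lt_orderTop_clusterTerm (by norm_num) _

theorem clusterTerm_eq_C_mul (m n : ℤ) (r : CoeffRing) :
    clusterTerm m n r = HahnSeries.C r * HahnSeries.single (toLex (m, n)) 1 := by
  change _ = HahnSeries.C r * clusterTerm m n 1
  rw [C_eq_clusterTerm, clusterTerm_mul, zero_add, zero_add, mul_one]

/-- The coefficients, viewed as constant series. -/
def coeffSeries (k : Fin 7) : ClusterSeries := HahnSeries.C (X k)

theorem thetaSeries_zero_mul_two :
    thetaSeries 0 * thetaSeries 2 = coeffSeries 1 * thetaSeries 1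
      + coeffSeries 3 * coeffSeries 4 * coeffSeries 5 := by
  simp only [thetaSeries, coeffSeries, C_eq_clusterTerm, Matrix.cons_val, mul_add,
    clusterTerm_mul]
  norm_num only [clusterTerm_eq_C_mul, map_mul, map_one]
  ring

theorem thetaSeries_one_mul_five :
    thetaSeries 1 * thetaSeries 5 = coeffSeries 0 * thetaSeries 0 ^ 2
      + coeffSeries 6 * coeffSeries 3 * thetaSeries 0
      + coeffSeries 2 * coeffSeries 3 ^ 2 * coeffSeries 4 := by
  simp only [thetaSeries, coeffSeries, C_eq_clusterTerm, Matrix.cons_val,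
    mul_add, clusterTerm_mul, pow_two]
  norm_num only [clusterTerm_eq_C_mul, map_mul, map_one]
  ring

theorem thetaSeries_zero_mul_four :
    thetaSeries 0 * thetaSeries 4 = coeffSeries 5 * thetaSeries 5
      + coeffSeries 1 * coeffSeries 2 * coeffSeries 3 := by
  simp only [thetaSeries, coeffSeries, C_eq_clusterTerm, Matrix.cons_val, mul_add,
    clusterTerm_mul, pow_two]
  norm_num only [clusterTerm_eq_C_mul, map_mul, map_one]
  ring

theorem thetaSeries_zero_mul_three :
    thetaSeries 0 * thetaSeries 3 = coeffSeries 1 * coeffSeries 2 * thetaSeries 2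
      + coeffSeries 6 * coeffSeries 5 * coeffSeries 1
      + coeffSeries 4 * coeffSeries 5 * thetaSeries 4 := by
  simp only [thetaSeries, coeffSeries, C_eq_clusterTerm, Matrix.cons_val, mul_add,
    clusterTerm_mul, pow_two, two_mul, clusterTerm_add, add_mul]
  norm_num only [clusterTerm_eq_C_mul, map_mul, map_one]
  ring

/-- The expansion map sending the cluster variables to their Laurent series. -/
def clusterExpansion : R13 →+* ClusterSeries :=
  eval₂Hom (HahnSeries.C.comp C) (Fin.append thetaSeries coeffSeries : Fin (6 + 7) → _)

theorem clusterExpansion_theta (k : Fin 6) : clusterExpansion (X (Fin.castAdd 7 k)) = thetaSeries k := by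
  rw [clusterExpansion, eval₂Hom_X', Fin.append_left]

theorem clusterExpansion_coeff (k : Fin 7) : clusterExpansion (X (Fin.natAdd 6 k)) = coeffSeries k := by
  rw [clusterExpansion, eval₂Hom_X', Fin.append_right]

theorem IC2_le_ker_clusterExpansion : IC2 ≤ RingHom.ker clusterExpansion := by
  have hx := (thetaSeries_order 0).1
  have h2 := thetaSeries_zero_mul_two
  have h3 := thetaSeries_zero_mul_three
  have h4 := thetaSeries_zero_mul_four
  have h5 := thetaSeries_one_mul_five
  have h14 : thetaSeries 1 * thetaSeries 4 = coeffSeries 5 * coeffSeries 0 * thetaSeries 0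
      + coeffSeries 6 * coeffSeries 3 * coeffSeries 5
      + coeffSeries 2 * coeffSeries 3 * thetaSeries 2 := by
    apply mul_left_cancel₀ hx
    linear_combination thetaSeries 1 * h4 + coeffSeries 5 * h5 - coeffSeries 2 * coeffSeries 3 * h2
  have h25 : thetaSeries 2 * thetaSeries 5 = coeffSeries 3 * coeffSeries 4 * thetaSeries 4
      + coeffSeries 6 * coeffSeries 1 * coeffSeries 3
      + coeffSeries 0 * coeffSeries 1 * thetaSeries 0 := by
    apply mul_left_cancel₀ hx
    linear_combination thetaSeries 5 * h2 + coeffSeries 1 * h5 - coeffSeries 3 * coeffSeries 4 * h4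
  have h24 : thetaSeries 2 * thetaSeries 4 = coeffSeries 3 * thetaSeries 3
      + coeffSeries 5 * coeffSeries 0 * coeffSeries 1 := by
    apply mul_left_cancel₀ hx
    linear_combination thetaSeries 4 * h2 + coeffSeries 1 * h14 - coeffSeries 3 * h3
  have h13 : thetaSeries 1 * thetaSeries 3 = coeffSeries 2 * thetaSeries 2 ^ 2
      + coeffSeries 6 * coeffSeries 5 * thetaSeries 2
      + coeffSeries 4 * coeffSeries 5 ^ 2 * coeffSeries 0 := by
    apply mul_left_cancel₀ hx
    linear_combination thetaSeries 1 * h3 + coeffSeries 4 * coeffSeries 5 * h14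
      - (coeffSeries 2 * thetaSeries 2 + coeffSeries 6 * coeffSeries 5) * h2
  have h35 : thetaSeries 3 * thetaSeries 5 = coeffSeries 4 * thetaSeries 4 ^ 2
      + coeffSeries 6 * coeffSeries 1 * thetaSeries 4
      + coeffSeries 0 * coeffSeries 1 ^ 2 * coeffSeries 2 := by
    apply mul_left_cancel₀ hx
    linear_combination thetaSeries 5 * h3 + coeffSeries 1 * coeffSeries 2 * h25
      - (coeffSeries 4 * thetaSeries 4 + coeffSeries 6 * coeffSeries 1) * h4
  have t0 : clusterExpansion (X 0) = thetaSeries 0 := clusterExpansion_theta 0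
  have t1 : clusterExpansion (X 1) = thetaSeries 1 := clusterExpansion_theta 1
  have t2 : clusterExpansion (X 2) = thetaSeries 2 := clusterExpansion_theta 2
  have t3 : clusterExpansion (X 3) = thetaSeries 3 := clusterExpansion_theta 3
  have t4 : clusterExpansion (X 4) = thetaSeries 4 := clusterExpansion_theta 4
  have t5 : clusterExpansion (X 5) = thetaSeries 5 := clusterExpansion_theta 5
  have c0 : clusterExpansion (X 6) = coeffSeries 0 := clusterExpansion_coeff 0
  have c1 : clusterExpansion (X 7) = coeffSeries 1 := clusterExpansion_coeff 1
  have c2 : clusterExpansion (X 8) = coeffSeries 2 := clusterExpansion_coeff 2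
  have c3 : clusterExpansion (X 9) = coeffSeries 3 := clusterExpansion_coeff 3
  have c4 : clusterExpansion (X 10) = coeffSeries 4 := clusterExpansion_coeff 4
  have c5 : clusterExpansion (X 11) = coeffSeries 5 := clusterExpansion_coeff 5
  have c6 : clusterExpansion (X 12) = coeffSeries 6 := clusterExpansion_coeff 6
  rw [IC2, Ideal.span_le]
  rintro _ ((⟨i, rfl⟩ | ⟨i, rfl⟩) | ⟨i, rfl⟩) <;> rw [SetLike.mem_coe, RingHom.mem_ker] <;>
    fin_cases i <;>
    simp only [g1, g2, g3, th, thp, aS, aP, lam, Fin.reduceFinMk, Fin.reduceAdd, Fin.zero_eta,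
      Fin.mk_one, Fin.isValue, zero_add, Matrix.cons_val, map_sub, map_mul, map_pow,
      t0, t1, t2, t3, t4, t5, c0, c1, c2, c3, c4, c5, c6]
  · linear_combination h2
  · linear_combination h24
  · linear_combination h4
  · linear_combination h5
  · linear_combination h13
  · linear_combination h35
  · linear_combination h3
  · linear_combination h25
  · linear_combination h14

/-- `R13` as the image of the polynomial ring in the cluster variables over `CoeffRing`. -/
def ofCluster : MvPolynomial (Fin 6) CoeffRing →+* R13 :=
  eval₂Hom (rename (Fin.natAdd 6)).toRingHom fun k => X (Fin.castAdd 7 k)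

theorem ofCluster_X (k : Fin 6) : ofCluster (X k) = X (Fin.castAdd 7 k) := by
  rw [ofCluster, eval₂Hom_X']

theorem ofCluster_C (r : CoeffRing) : ofCluster (C r) = rename (Fin.natAdd 6) r := by
  rw [ofCluster, eval₂Hom_C]
  rfl

theorem ofCluster_surjective : Function.Surjective ofCluster := by
  intro f
  induction f using MvPolynomial.induction_on with
  | C a => exact ⟨C (C a), by rw [ofCluster_C, rename_C]⟩
  | add p q hp hq =>
    obtain ⟨p, rfl⟩ := hp
    obtain ⟨q, rfl⟩ := hq
    exact ⟨p + q, map_add _ _ _⟩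
  | mul_X p i hp =>
    obtain ⟨p, rfl⟩ := hp
    induction i using Fin.addCases (m := 6) (n := 7) with
    | left k => exact ⟨p * X k, by rw [map_mul, ofCluster_X]⟩
    | right k => exact ⟨p * C (X k), by rw [map_mul, ofCluster_C, rename_X]⟩

theorem clusterExpansion_ofCluster (p : MvPolynomial (Fin 6) CoeffRing) :
    clusterExpansion (ofCluster p) = eval₂ HahnSeries.C thetaSeries p := by
  have h : clusterExpansion.comp ofCluster = eval₂Hom HahnSeries.C thetaSeries := by
    refine ringHom_ext' (ringHom_ext' ?_ fun k => ?_) fun k => ?_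
    · ext a : 1
      simp only [RingHom.comp_apply, ofCluster_C, rename_C, clusterExpansion, eval₂Hom_C]
    · simp only [RingHom.comp_apply, ofCluster_C, rename_X, eval₂Hom_C]
      exact clusterExpansion_coeff k
    · simp only [RingHom.comp_apply, ofCluster_X, eval₂Hom_X']
      exact clusterExpansion_theta k
  exact congrArg (fun g => g p) h

/-- Exponents of cluster monomials: supported on two cyclically adjacent cluster variables. -/
def clusterExponents : Set (Fin 6 →₀ ℕ) :=
  {e | ∀ i, (e i = 0 ∨ e (i + 2) = 0) ∧ (e i = 0 ∨ e (i + 3) = 0)}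

theorem injOn_order_clusterExponents :
    Set.InjOn (fun e : Fin 6 →₀ ℕ => ∑ i, e i • (thetaSeries i).order) clusterExponents := by
  intro e he f hf hef
  have h : ∑ i, e i • thetaOrder i = ∑ i, f i • thetaOrder i := by
    simp only [(thetaSeries_order _).2] at hef
    exact hef
  have hsupp : ∀ g ∈ clusterExponents, ∃ i, ∀ j, j ≠ i → j ≠ i + 1 → g j = 0 := by
    intro g hg
    simp only [clusterExponents, Set.mem_ofPred_eq, Fin.forall_fin_succ, Fin.exists_fin_succ] at hg ⊢
    simp at hg ⊢
    grind
  obtain ⟨i, hi⟩ := hsupp e he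
  obtain ⟨j, hj⟩ := hsupp f hf
  simp only [Fin.sum_univ_six, thetaOrder, Prod.ext_iff, Matrix.cons_val, Prod.fst_add,
    Prod.snd_add, nsmul_eq_mul] at h
  simp at h
  have key : e 0 = f 0 ∧ e 1 = f 1 ∧ e 2 = f 2 ∧ e 3 = f 3 ∧ e 4 = f 4 ∧ e 5 = f 5 := by
    clear hef hsupp he hf
    fin_cases i <;> simp [Fin.forall_fin_succ] at hi <;> fin_cases j <;>
      simp [Fin.forall_fin_succ] at hj <;> omega
  ext k
  fin_cases k <;> simp [key]

/-- The grading for which each relation lowers the weight. -/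
def clusterWeight : Fin 6 → ℕ := ![2, 3, 2, 3, 2, 3]

theorem C_mul_X_pow_mem_restrictSupport {n : ℕ} (r : CoeffRing) (k : Fin 6) (d : ℕ)
    (h : d * clusterWeight k < n) :
    C r * X k ^ d ∈ restrictSupport CoeffRing {u | Finsupp.weight clusterWeight u < n} := by
  rw [C_mul_X_pow_eq_monomial, monomial_mem_restrictSupport]
  left
  rwa [Set.mem_ofPred_eq, Finsupp.weight_single, smul_eq_mul]

set_option linter.unusedSimpArgs false in
/-- Products of cluster variables that are not adjacent reduce to terms of smaller weight. -/
theorem exists_reduction (i j : Fin 6) (hij : j = i + 2 ∨ j = i + 3) :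
    ∃ q ∈ restrictSupport CoeffRing
      {u | Finsupp.weight clusterWeight u < clusterWeight i + clusterWeight j},
      X i * X j - q ∈ IC2.comap ofCluster := by
  suffices h : ∃ r s t : CoeffRing, ∃ k l m : Fin 6, ∃ a b c : ℕ,
      a * clusterWeight k < clusterWeight i + clusterWeight j ∧
      b * clusterWeight l < clusterWeight i + clusterWeight j ∧
      c * clusterWeight m < clusterWeight i + clusterWeight j ∧
      ofCluster (X i * X j - (C r * X k ^ a + C s * X l ^ b + C t * X m ^ c)) ∈ IC2 by
    obtain ⟨r, s, t, k, l, m, a, b, c, ha, hb, hc, h⟩ := h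
    exact ⟨_, add_mem (add_mem (C_mul_X_pow_mem_restrictSupport r k a ha)
      (C_mul_X_pow_mem_restrictSupport s l b hb)) (C_mul_X_pow_mem_restrictSupport t m c hc), h⟩
  have hg1 : ∀ i, g1 i ∈ IC2 := fun i => Ideal.subset_span (Or.inl (Or.inl ⟨i, rfl⟩))
  have hg2 : ∀ i, g2 i ∈ IC2 := fun i => Ideal.subset_span (Or.inl (Or.inr ⟨i, rfl⟩))
  have hg3 : ∀ i, g3 i ∈ IC2 := fun i => Ideal.subset_span (Or.inr ⟨i, rfl⟩)
  have hC : ∀ k, ofCluster (C (X k)) = X (Fin.natAdd 6 k) := fun k => by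
    rw [ofCluster_C, rename_X]
  have t0 : ofCluster (X 0) = X 0 := ofCluster_X 0
  have t1 : ofCluster (X 1) = X 1 := ofCluster_X 1
  have t2 : ofCluster (X 2) = X 2 := ofCluster_X 2
  have t3 : ofCluster (X 3) = X 3 := ofCluster_X 3
  have t4 : ofCluster (X 4) = X 4 := ofCluster_X 4
  have t5 : ofCluster (X 5) = X 5 := ofCluster_X 5
  have c0 : ofCluster (C (X 0)) = X 6 := hC 0
  have c1 : ofCluster (C (X 1)) = X 7 := hC 1
  have c2 : ofCluster (C (X 2)) = X 8 := hC 2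
  have c3 : ofCluster (C (X 3)) = X 9 := hC 3
  have c4 : ofCluster (C (X 4)) = X 10 := hC 4
  have c5 : ofCluster (C (X 5)) = X 11 := hC 5
  have c6 : ofCluster (C (X 6)) = X 12 := hC 6
  obtain rfl | rfl := hij <;> fin_cases i
  · refine ⟨X 1, X 3 * X 4 * X 5, 0, 1, 0, 0, 1, 0, 0, by decide, by decide, by decide, ?_⟩
    convert hg1 0 using 1
    simp [t0, t1, t2, t3, t4, t5, c0, c1, c2, c3, c4, c5, c6, g1, g2, g3, th, thp, aS, aP, lam]
    ring
  · refine ⟨X 2, X 6 * X 5, X 4 * X 5 * X 5 * X 0, 2, 2, 0, 2, 1, 0, by decide, by decide, by decide, ?_⟩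
    convert hg2 1 using 1
    simp [t0, t1, t2, t3, t4, t5, c0, c1, c2, c3, c4, c5, c6, g1, g2, g3, th, thp, aS, aP, lam]
    ring
  · refine ⟨X 3, X 5 * X 0 * X 1, 0, 3, 0, 0, 1, 0, 0, by decide, by decide, by decide, ?_⟩
    convert hg1 1 using 1
    simp [t0, t1, t2, t3, t4, t5, c0, c1, c2, c3, c4, c5, c6, g1, g2, g3, th, thp, aS, aP, lam]
    ring
  · refine ⟨X 4, X 6 * X 1, X 0 * X 1 * X 1 * X 2, 4, 4, 0, 2, 1, 0, by decide, by decide, by decide, ?_⟩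
    convert hg2 2 using 1
    simp [t0, t1, t2, t3, t4, t5, c0, c1, c2, c3, c4, c5, c6, g1, g2, g3, th, thp, aS, aP, lam]
    ring
  · refine ⟨X 5, X 1 * X 2 * X 3, 0, 5, 0, 0, 1, 0, 0, by decide, by decide, by decide, ?_⟩
    convert hg1 2 using 1
    simp [t0, t1, t2, t3, t4, t5, c0, c1, c2, c3, c4, c5, c6, g1, g2, g3, th, thp, aS, aP, lam]
    ring
  · refine ⟨X 0, X 6 * X 3, X 2 * X 3 * X 3 * X 4, 0, 0, 0, 2, 1, 0, by decide, by decide, by decide, ?_⟩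
    convert hg2 0 using 1
    simp [t0, t1, t2, t3, t4, t5, c0, c1, c2, c3, c4, c5, c6, g1, g2, g3, th, thp, aS, aP, lam]
    ring
  · refine ⟨X 1 * X 2, X 6 * X 5 * X 1, X 4 * X 5, 2, 0, 4, 1, 0, 1, by decide, by decide, by decide, ?_⟩
    convert hg3 0 using 1
    simp [t0, t1, t2, t3, t4, t5, c0, c1, c2, c3, c4, c5, c6, g1, g2, g3, th, thp, aS, aP, lam]
    ring
  · refine ⟨X 5 * X 0, X 6 * X 3 * X 5, X 2 * X 3, 0, 0, 2, 1, 0, 1, by decide, by decide, by decide, ?_⟩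
    convert hg3 2 using 1
    simp [t0, t1, t2, t3, t4, t5, c0, c1, c2, c3, c4, c5, c6, g1, g2, g3, th, thp, aS, aP, lam]
    ring
  · refine ⟨X 3 * X 4, X 6 * X 1 * X 3, X 0 * X 1, 4, 0, 0, 1, 0, 1, by decide, by decide, by decide, ?_⟩
    convert hg3 1 using 1
    simp [t0, t1, t2, t3, t4, t5, c0, c1, c2, c3, c4, c5, c6, g1, g2, g3, th, thp, aS, aP, lam]
    ring
  · refine ⟨X 1 * X 2, X 6 * X 5 * X 1, X 4 * X 5, 2, 0, 4, 1, 0, 1, by decide, by decide, by decide, ?_⟩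
    convert hg3 0 using 1
    simp [t0, t1, t2, t3, t4, t5, c0, c1, c2, c3, c4, c5, c6, g1, g2, g3, th, thp, aS, aP, lam]
    ring
  · refine ⟨X 5 * X 0, X 6 * X 3 * X 5, X 2 * X 3, 0, 0, 2, 1, 0, 1, by decide, by decide, by decide, ?_⟩
    convert hg3 2 using 1
    simp [t0, t1, t2, t3, t4, t5, c0, c1, c2, c3, c4, c5, c6, g1, g2, g3, th, thp, aS, aP, lam]
    ring
  · refine ⟨X 3 * X 4, X 6 * X 1 * X 3, X 0 * X 1, 4, 0, 0, 1, 0, 1, by decide, by decide, by decide, ?_⟩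
    convert hg3 1 using 1
    simp [t0, t1, t2, t3, t4, t5, c0, c1, c2, c3, c4, c5, c6, g1, g2, g3, th, thp, aS, aP, lam]
    ring

theorem restrictSupport_clusterExponents_sup :
    restrictSupport CoeffRing clusterExponents
      ⊔ (IC2.comap ofCluster).restrictScalars CoeffRing = ⊤ := by
  refine restrictSupport_sup_eq_top_of_reduction clusterWeight _ _ fun e he => ?_
  obtain ⟨i, j, hij, hi, hj⟩ : ∃ i j, (j = i + 2 ∨ j = i + 3) ∧ e i ≠ 0 ∧ e j ≠ 0 := by
    simp only [clusterExponents, Set.mem_ofPred_eq, not_forall] at he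
    obtain ⟨i, hi⟩ := he
    by_cases h : e i = 0 ∨ e (i + 2) = 0
    · have h3 : ¬(e i = 0 ∨ e (i + 3) = 0) := fun h3 => hi ⟨h, h3⟩
      rw [not_or] at h3
      exact ⟨i, i + 3, Or.inr rfl, h3⟩
    · rw [not_or] at h
      exact ⟨i, i + 2, Or.inl rfl, h⟩
  have hne : i ≠ j := by
    obtain rfl | rfl := hij <;> simp
  obtain ⟨q, hq, hqJ⟩ := exists_reduction i j hij
  refine ⟨Finsupp.single i 1 + Finsupp.single j 1, fun k => ?_, q, ?_, ?_⟩
  · have := Nat.one_le_iff_ne_zero.2 hi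
    have := Nat.one_le_iff_ne_zero.2 hj
    simp only [Finsupp.add_apply, Finsupp.single_apply]
    split_ifs with h1 h2 h2
    · exact absurd (h1.trans h2.symm) hne
    all_goals subst_vars; omega
  · simpa only [map_add, Finsupp.weight_single, one_smul] using hq
  · rwa [← one_mul (1 : CoeffRing), ← monomial_mul]

end

/-- The C₂ cluster ideal is a prime ideal of `R13`; equivalently, the
C₂ cluster variety is irreducible and its coordinate ring is an integral domain. -/
theorem IC2_isPrime : IC2.IsPrime := by
  have hker : IC2 = RingHom.ker clusterExpansion := by
    refine le_antisymm IC2_le_ker_clusterExpansion fun f hf => ?_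
    obtain ⟨p, rfl⟩ := ofCluster_surjective f
    obtain ⟨s, hs, q, hq, rfl⟩ := Submodule.mem_sup.1
      (restrictSupport_clusterExponents_sup ▸ Submodule.mem_top : p ∈ _)
    have hq' : ofCluster q ∈ IC2 := hq
    have hs0 : s = 0 := by
      refine eq_zero_of_eval₂_eq_zero_of_injOn_order thetaSeries (fun i => (thetaSeries_order i).1)
        s (injOn_order_clusterExponents.mono hs) ?_
      rw [← clusterExpansion_ofCluster]
      rw [RingHom.mem_ker, map_add, map_add, RingHom.mem_ker.1 (IC2_le_ker_clusterExpansion hq'), add_zero]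
        at hf
      exact hf
    rwa [hs0, zero_add]
  rw [hker]
  exact RingHom.ker_isPrime clusterExpansion
end

section
/- The quotient ring R₁₃/I_{C₂} has Krull dimension 9; that is, the C₂ cluster variety X_{C₂} ⊆ ℂ¹³ is a 9-dimensional affine variety of codimension 4. -/
/-!
The C₂ cluster variety.

`R13` is the polynomial ring over ℂ in the 13 variables, indexed as follows:
`0 ↦ θ₁, 1 ↦ θ₁₂, 2 ↦ θ₂, 3 ↦ θ₂₃, 4 ↦ θ₃, 5 ↦ θ₃₁,
 6 ↦ A₁, 7 ↦ A₁₂, 8 ↦ A₂, 9 ↦ A₂₃, 10 ↦ A₃, 11 ↦ A₃₁, 12 ↦ λ`.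
Indices `i : Fin 3` stand for the (cyclic) indices 1,2,3, with `Fin 3` addition.
-/

open MvPolynomial

theorem ringKrullDim_eq_of_isIntegral_of_injective {R S : Type*} [CommRing R] [CommRing S]
    [Algebra R S] [Algebra.IsIntegral R S] (hinj : Function.Injective (algebraMap R S)) :
    ringKrullDim S = ringKrullDim R := by
  apply le_antisymm
  · refine Order.krullDim_le_of_strictMono (PrimeSpectrum.comap (algebraMap R S)) ?_
    intro p q hpq
    exact Ideal.IsIntegral.comap_lt_comap hpq
  · refine iSup_le fun l ↦ ?_
    have hker : Ideal.comap (algebraMap R S) ⊥ ≤ l.head.asIdeal := by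
      rw [← RingHom.ker_eq_comap_bot, (RingHom.injective_iff_ker_eq_bot _).1 hinj]
      exact bot_le
    obtain ⟨P, -, hP, hPl⟩ :=
      Ideal.exists_ideal_over_prime_of_isIntegral l.head.asIdeal (⊥ : Ideal S) hker
    have : P.LiesOver (RelSeries.head l).asIdeal := ⟨hPl.symm⟩
    obtain ⟨L, hL, -, -⟩ := Ideal.exists_ltSeries_of_hasGoingUp l P
    rw [← hL]
    exact Order.LTSeries.length_le_krullDim L

theorem isIntegral_of_mul_mem_span_of_hexagon {S B : Type*} [CommRing S] [CommRing B] [Algebra S B]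
    (t : Fin 6 → B)
    (h : ∀ i j, j ≠ i + 1 → i ≠ j + 1 →
      t i * t j ∈ Submodule.span S (insert 1 (Set.range t))) (i : Fin 6) :
    IsIntegral S (t i) := by
  set G : Set B := insert 1 (Set.range t) with hG
  set N : Submodule S B := Submodule.span S G with hN
  have one_mem : (1 : B) ∈ N := Submodule.subset_span (Set.mem_insert _ _)
  have t_mem (j) : t j ∈ N := Submodule.subset_span (Set.mem_insert_of_mem _ ⟨j, rfl⟩)
  have le_sq : N ≤ N * N := fun x hx ↦ by simpa using Submodule.mul_mem_mul hx one_mem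
  have cube_le : N * N * N ≤ N * N := by
    conv_lhs => rw [hN, Submodule.span_mul_span, Submodule.span_mul_span]
    rw [Submodule.span_le]
    rintro _ ⟨_, ⟨x, hx, y, hy, rfl⟩, z, hz, rfl⟩
    have hx' : x ∈ N := Submodule.subset_span hx
    have hy' : y ∈ N := Submodule.subset_span hy
    have hz' : z ∈ N := Submodule.subset_span hz
    simp only [SetLike.mem_coe]
    rcases hx with rfl | ⟨i, rfl⟩
    · simpa using Submodule.mul_mem_mul hy' hz'
    rcases hy with rfl | ⟨j, rfl⟩
    · simpa using Submodule.mul_mem_mul hx' hz'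
    rcases hz with rfl | ⟨k, rfl⟩
    · simpa using Submodule.mul_mem_mul hx' hy'
    have key : ∀ i j k : Fin 6, (j ≠ i + 1 ∧ i ≠ j + 1) ∨ (k ≠ i + 1 ∧ i ≠ k + 1) ∨
        (k ≠ j + 1 ∧ j ≠ k + 1) := by decide
    rcases key i j k with ⟨h1, h2⟩ | ⟨h1, h2⟩ | ⟨h1, h2⟩
    · exact Submodule.mul_mem_mul (h _ _ h1 h2) hz'
    · rw [mul_right_comm]
      exact Submodule.mul_mem_mul (h _ _ h1 h2) hy'
    · rw [mul_assoc]
      exact Submodule.mul_mem_mul hx' (h _ _ h1 h2)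
  have sq_le : (N * N) * (N * N) ≤ N * N := by
    rw [← mul_assoc]
    exact (mul_le_mul_left cube_le N).trans cube_le
  let T : Subalgebra S B := (N * N).toSubalgebra (le_sq one_mem)
    fun x y hx hy ↦ sq_le (Submodule.mul_mem_mul hx hy)
  have hfg : N.FG := Submodule.fg_span ((Set.finite_range t).insert 1)
  exact IsIntegral.of_mem_of_fg T (by simpa [T] using hfg.mul hfg) _ (le_sq (t_mem i))

theorem isIntegral_of_clusterRelations {S B : Type*} [CommRing S] [CommRing B] [Algebra S B]
    (t : Fin 6 → B) (a : Fin 6 → S) (l u v : S)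
    (hu : t 0 + t 2 + t 4 = algebraMap S B u) (hv : t 1 + t 3 + t 5 = algebraMap S B v)
    (h02 : t 0 * t 2 = a 1 • t 1 + (a 3 * a 4 * a 5) • 1)
    (h24 : t 2 * t 4 = a 3 • t 3 + (a 5 * a 0 * a 1) • 1)
    (h40 : t 4 * t 0 = a 5 • t 5 + (a 1 * a 2 * a 3) • 1)
    (h51 : t 5 * t 1 = a 0 • t 0 ^ 2 + (l * a 3) • t 0 + (a 2 * a 3 ^ 2 * a 4) • 1)
    (h13 : t 1 * t 3 = a 2 • t 2 ^ 2 + (l * a 5) • t 2 + (a 4 * a 5 ^ 2 * a 0) • 1)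
    (h35 : t 3 * t 5 = a 4 • t 4 ^ 2 + (l * a 1) • t 4 + (a 0 * a 1 ^ 2 * a 2) • 1)
    (h03 : t 0 * t 3 = (a 1 * a 2) • t 2 + (l * a 5 * a 1) • 1 + (a 4 * a 5) • t 4)
    (h25 : t 2 * t 5 = (a 3 * a 4) • t 4 + (l * a 1 * a 3) • 1 + (a 0 * a 1) • t 0)
    (h41 : t 4 * t 1 = (a 5 * a 0) • t 0 + (l * a 3 * a 5) • 1 + (a 2 * a 3) • t 2)
    (i : Fin 6) : IsIntegral S (t i) := by
  refine isIntegral_of_mul_mem_span_of_hexagon t ?_ i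
  set N : Submodule S B := Submodule.span S (insert 1 (Set.range t)) with hN
  have one_mem : (1 : B) ∈ N := Submodule.subset_span (Set.mem_insert _ _)
  have t_mem (j) : t j ∈ N := Submodule.subset_span (Set.mem_insert_of_mem _ ⟨j, rfl⟩)
  have lin (c d e : S) (j k : Fin 6) : c • t j + d • 1 + e • t k ∈ N :=
    add_mem (add_mem (N.smul_mem _ (t_mem _)) (N.smul_mem _ one_mem)) (N.smul_mem _ (t_mem _))
  have lin' (c d : S) (j : Fin 6) : c • t j + d • 1 ∈ N :=
    add_mem (N.smul_mem _ (t_mem _)) (N.smul_mem _ one_mem)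
  have m02 : t 0 * t 2 ∈ N := h02 ▸ lin' _ _ _
  have m24 : t 2 * t 4 ∈ N := h24 ▸ lin' _ _ _
  have m40 : t 4 * t 0 ∈ N := h40 ▸ lin' _ _ _
  have m03 : t 0 * t 3 ∈ N := h03 ▸ lin _ _ _ _ _
  have m25 : t 2 * t 5 ∈ N := h25 ▸ lin _ _ _ _ _
  have m41 : t 4 * t 1 ∈ N := h41 ▸ lin _ _ _ _ _
  have sq {w : S} {x y z : B} (hw : x + y + z = algebraMap S B w) (hx : x ∈ N)
      (hxy : x * y ∈ N) (hzx : z * x ∈ N) : x ^ 2 ∈ N := by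
    have : x ^ 2 = w • x - x * y - z * x := by
      rw [Algebra.smul_def, ← hw]
      ring
    rw [this]
    exact sub_mem (sub_mem (N.smul_mem _ hx) hxy) hzx
  have m00 : t 0 ^ 2 ∈ N := sq hu (t_mem 0) m02 m40
  have m22 : t 2 ^ 2 ∈ N := sq (by rw [← hu]; ring) (t_mem 2) m24 m02
  have m44 : t 4 ^ 2 ∈ N := sq (by rw [← hu]; ring) (t_mem 4) m40 m24
  have quad {x : B} (c d e : S) (j : Fin 6) (hx : x ∈ N) : c • x + d • t j + e • 1 ∈ N :=
    add_mem (add_mem (N.smul_mem _ hx) (N.smul_mem _ (t_mem _))) (N.smul_mem _ one_mem)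
  have m51 : t 5 * t 1 ∈ N := h51 ▸ quad _ _ _ _ m00
  have m13 : t 1 * t 3 ∈ N := h13 ▸ quad _ _ _ _ m22
  have m35 : t 3 * t 5 ∈ N := h35 ▸ quad _ _ _ _ m44
  have m11 : t 1 ^ 2 ∈ N := sq hv (t_mem 1) m13 m51
  have m33 : t 3 ^ 2 ∈ N := sq (by rw [← hv]; ring) (t_mem 3) m35 m13
  have m55 : t 5 ^ 2 ∈ N := sq (by rw [← hv]; ring) (t_mem 5) m51 m35
  intro i j hij hji
  fin_cases i <;> fin_cases j <;>
    first
    | exact absurd rfl hij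
    | exact absurd rfl hji
    | (simp only [← pow_two]; assumption)
    | assumption
    | (rw [mul_comm]; assumption)

section Chart

variable {K : Type*} [Field K] [Algebra ℂ K]

/-- The point of the cluster variety with coordinates `θ₁ = c 0`, `θ₁₂ = c 1` and coefficients
`A₁, A₁₂, A₂, A₂₃, A₃, A₃₁, λ` given by `c 2, …, c 8`, in the chart `θ₁ θ₁₂ ≠ 0`. -/
def clusterChart (c : Fin 9 → K) : Fin 13 → K :=
  let t2 := (c 3 * c 1 + c 5 * c 6 * c 7) / c 0
  let t31 := (c 2 * c 0 ^ 2 + c 8 * c 5 * c 0 + c 4 * c 5 ^ 2 * c 6) / c 1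
  let t3 := (c 7 * c 2 * c 0 + c 8 * c 5 * c 7 + c 4 * c 5 * t2) / c 1
  let t23 := (c 3 * c 4 * t2 + c 8 * c 7 * c 3 + c 6 * c 7 * t3) / c 0
  ![c 0, c 1, t2, t23, t3, t31, c 2, c 3, c 4, c 5, c 6, c 7, c 8]

theorem aeval_clusterChart_eq_zero (c : Fin 9 → K) (h0 : c 0 ≠ 0) (h1 : c 1 ≠ 0) {p : R13}
    (hp : p ∈ IC2) : aeval (clusterChart c) p = 0 := by
  suffices IC2 ≤ RingHom.ker (aeval (clusterChart c) : R13 →ₐ[ℂ] K) from this hp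
  rw [IC2, Ideal.span_le]
  rintro _ ((⟨i, rfl⟩ | ⟨i, rfl⟩) | ⟨i, rfl⟩) <;> fin_cases i <;>
    simp [g1, g2, g3, th, thp, aS, aP, lam, clusterChart] <;> field_simp <;> ring

end Chart

/-- The class of the `i`-th variable of `R13` in the coordinate ring of the cluster variety. -/
noncomputable def clusterCoord (i : Fin 13) : R13 ⧸ IC2 := Ideal.Quotient.mk IC2 (X i)

/-- The parameters `θ₁ + θ₂ + θ₃`, `θ₁₂ + θ₂₃ + θ₃₁`, `A₁, A₁₂, A₂, A₂₃, A₃, A₃₁, λ` of the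
coordinate ring of the cluster variety. -/
noncomputable def clusterParam : Fin 9 → R13 ⧸ IC2 :=
  ![clusterCoord 0 + clusterCoord 2 + clusterCoord 4,
    clusterCoord 1 + clusterCoord 3 + clusterCoord 5,
    clusterCoord 6, clusterCoord 7, clusterCoord 8, clusterCoord 9, clusterCoord 10,
    clusterCoord 11, clusterCoord 12]

theorem isIntegral_adjoin_clusterParam {B : Type*} [CommRing B] [Algebra ℂ B]
    (ψ : R13 ⧸ IC2 →ₐ[ℂ] B) (hψ : Function.Surjective ψ) :
    Algebra.IsIntegral (Algebra.adjoin ℂ (Set.range (ψ ∘ clusterParam))) B := by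
  set S := Algebra.adjoin ℂ (Set.range (ψ ∘ clusterParam))
  let y (i : Fin 9) : S := ⟨ψ (clusterParam i), Algebra.subset_adjoin ⟨i, rfl⟩⟩
  let t : Fin 6 → B := fun i ↦ ψ (clusterCoord (Fin.castLE (by decide) i))
  have rel {p : R13} (hp : p ∈ Set.range g1 ∪ Set.range g2 ∪ Set.range g3) :
      ψ (Ideal.Quotient.mk IC2 p) = 0 := by
    have hp' : p ∈ IC2 := Ideal.subset_span hp
    rw [Ideal.Quotient.eq_zero_iff_mem.2 hp', map_zero]
  have r1 (i) := rel (Or.inl (Or.inl ⟨i, rfl⟩))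
  have r2 (i) := rel (Or.inl (Or.inr ⟨i, rfl⟩))
  have r3 (i) := rel (Or.inr ⟨i, rfl⟩)
  have r10 := r1 0
  have r11 := r1 1
  have r12 := r1 2
  have r20 := r2 0
  have r21 := r2 1
  have r22 := r2 2
  have r30 := r3 0
  have r31 := r3 1
  have r32 := r3 2
  simp [g1, g2, g3, th, thp, aS, aP, lam] at r10 r11 r12 r20 r21 r22 r30 r31 r32
  have ht : ∀ i, IsIntegral S (t i) := by
    apply isIntegral_of_clusterRelations t ![y 2, y 3, y 4, y 5, y 6, y 7] (y 8) (y 0) (y 1) <;>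
      simp [t, y, clusterParam, clusterCoord, Subalgebra.smul_def]
    exacts [by linear_combination r10, by linear_combination r11, by linear_combination r12,
      by linear_combination r20, by linear_combination r21, by linear_combination r22,
      by linear_combination r30, by linear_combination r31, by linear_combination r32]
  have hx (i : Fin 13) : IsIntegral S (ψ (clusterCoord i)) := by
    fin_cases i
    exacts [ht 0, ht 1, ht 2, ht 3, ht 4, ht 5,
      isIntegral_algebraMap (x := y 2), isIntegral_algebraMap (x := y 3),
      isIntegral_algebraMap (x := y 4), isIntegral_algebraMap (x := y 5),
      isIntegral_algebraMap (x := y 6), isIntegral_algebraMap (x := y 7),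
      isIntegral_algebraMap (x := y 8)]
  refine ⟨fun b ↦ ?_⟩
  obtain ⟨q, rfl⟩ := hψ b
  obtain ⟨p, rfl⟩ := Ideal.Quotient.mk_surjective q
  induction p using MvPolynomial.induction_on with
  | C c =>
    have : ψ (Ideal.Quotient.mk IC2 (C c)) = algebraMap S B (algebraMap ℂ S c) :=
      ψ.commutes c
    rw [this]
    exact isIntegral_algebraMap
  | add p q hp hq =>
    rw [map_add, map_add]
    exact hp.add hq
  | mul_X p i hp =>
    rw [map_mul, map_mul]
    exact hp.mul (hx i)

theorem algebraicIndependent_clusterParam_of_surjective {D : Type} [CommRing D] [IsDomain D]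
    [Algebra ℂ D] (ψ : R13 ⧸ IC2 →ₐ[ℂ] D) (hψ : Function.Surjective ψ) {z : Fin 9 → D}
    (hz : AlgebraicIndependent ℂ z) : AlgebraicIndependent ℂ clusterParam := by
  have := isIntegral_adjoin_clusterParam ψ hψ
  have : Algebra.IsAlgebraic (Algebra.adjoin ℂ (Set.range (ψ ∘ clusterParam))) D :=
    ⟨fun x ↦ (Algebra.IsIntegral.isIntegral x).isAlgebraic⟩
  have hb := Algebra.IsAlgebraic.isTranscendenceBasis_of_le_trdeg_of_finite ℂ
    (ψ ∘ clusterParam) hz.cardinalMk_le_trdeg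
  exact hb.1.of_comp ψ

theorem algebraicIndependent_clusterParam : AlgebraicIndependent ℂ clusterParam := by
  let K := FractionRing (MvPolynomial (Fin 9) ℂ)
  let c : Fin 9 → K := fun i ↦ algebraMap (MvPolynomial (Fin 9) ℂ) K (X i)
  have hc : AlgebraicIndependent ℂ c :=
    (algebraicIndependent_X (Fin 9) ℂ).map' (f := IsScalarTower.toAlgHom ℂ _ K)
      (IsFractionRing.injective (MvPolynomial (Fin 9) ℂ) K)
  let φ : R13 ⧸ IC2 →ₐ[ℂ] K := Ideal.Quotient.liftₐ IC2 (aeval (clusterChart c))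
    fun p hp ↦ aeval_clusterChart_eq_zero c (hc.ne_zero 0) (hc.ne_zero 1) hp
  have hφ (i) : φ (clusterCoord i) = clusterChart c i := aeval_X _ i
  let ψ : R13 ⧸ IC2 →ₐ[ℂ] φ.range := φ.rangeRestrict
  let z : Fin 9 → φ.range :=
    fun i ↦ ψ (clusterCoord (![0, 1, 6, 7, 8, 9, 10, 11, 12] i))
  have hz : AlgebraicIndependent ℂ z := by
    apply AlgebraicIndependent.of_comp φ.range.val
    convert hc using 1
    funext i
    have : (φ.range.val ∘ z) i = clusterChart c (![0, 1, 6, 7, 8, 9, 10, 11, 12] i) := hφ _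
    rw [this]
    fin_cases i <;> rfl
  exact algebraicIndependent_clusterParam_of_surjective ψ φ.rangeRestrict_surjective hz

/-- The quotient ring `R13 ⧸ IC2` has Krull dimension 9; that is, the
C₂ cluster variety is a 9-dimensional affine variety of codimension 4 in ℂ¹³. -/
theorem IC2_krullDim : ringKrullDim (R13 ⧸ IC2) = 9 := by
  have := isIntegral_adjoin_clusterParam (AlgHom.id ℂ (R13 ⧸ IC2)) Function.surjective_id
  rw [AlgHom.coe_id, Function.id_comp] at this
  rw [ringKrullDim_eq_of_isIntegral_of_injective
      (R := Algebra.adjoin ℂ (Set.range clusterParam))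
      Subtype.val_injective,
    ← algebraicIndependent_clusterParam.aevalEquiv.toRingEquiv.ringKrullDim,
    MvPolynomial.ringKrullDim_of_isNoetherianRing, ringKrullDim_eq_zero_of_field]
  simp
end

section
/- In the localization of R₁₃ away from θ₁₂ (the ring of fractions with denominators powers of θ₁₂), the extension of the ideal I_{C₂} is generated by the images of the four generators θ₃₁θ₁₂ − A₁θ₁² − λA₂₃θ₁ − A₂A₂₃²A₃, θ₁₂θ₂₃ − A₂θ₂² − λA₃₁θ₂ − A₃A₃₁²A₁, θ₁θ₂ − A₁₂θ₁₂ − A₂₃A₃A₃₁, and θ₃θ₁₂ − A₃₁A₁θ₁ − λA₂₃A₃₁ − A₂A₂₃θ₂. In particular, on the open set (θ₁₂ ≠ 0) the cluster variety X_{C₂} is a complete intersection of codimension 4. -/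
/-!
The C₂ cluster variety.

`R13` is the polynomial ring over ℂ in the 13 variables, indexed as follows:
`0 ↦ θ₁, 1 ↦ θ₁₂, 2 ↦ θ₂, 3 ↦ θ₂₃, 4 ↦ θ₃, 5 ↦ θ₃₁,
 6 ↦ A₁, 7 ↦ A₁₂, 8 ↦ A₂, 9 ↦ A₂₃, 10 ↦ A₃, 11 ↦ A₃₁, 12 ↦ λ`.
Indices `i : Fin 3` stand for the (cyclic) indices 1,2,3, with `Fin 3` addition.
-/

open MvPolynomial

/-- An ideal of the localization away from `a` that contains the image of `a * x` contains that
of `x`. -/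
theorem Ideal.algebraMap_mem_of_away_mul_mem {R : Type*} [CommRing R] {a x : R}
    {J : Ideal (Localization.Away a)}
    (h : algebraMap R (Localization.Away a) (a * x) ∈ J) :
    algebraMap R (Localization.Away a) x ∈ J := by
  rw [map_mul] at h
  exact (Ideal.unit_mul_mem_iff_mem J (IsLocalization.Away.algebraMap_isUnit a)).mp h

theorem thp_zero_mul_g1_one :
    thp 0 * g1 1 = th 1 * g3 2 - aP 1 * g2 1 + aP 2 * aS 0 * g1 0 := by
  simp only [g1, g2, g3, Fin.isValue, Fin.reduceAdd, zero_add]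
  ring

theorem thp_zero_mul_g1_two :
    thp 0 * g1 2 = th 0 * g3 2 - aP 2 * g2 0 + aS 1 * aP 1 * g1 0 := by
  simp only [g1, g2, g3, Fin.isValue, Fin.reduceAdd, zero_add]
  ring

theorem thp_zero_mul_g3_zero :
    thp 0 * g3 0 = th 0 * g2 1 + (aS 1 * th 1 + lam * aP 2) * g1 0 - aS 2 * aP 2 * g3 2 := by
  simp only [g1, g2, g3, Fin.isValue, Fin.reduceAdd, zero_add]
  ring

theorem thp_zero_mul_g3_one :
    thp 0 * g3 1 = th 1 * g2 0 + (aS 0 * th 0 + lam * aP 1) * g1 0 - aP 1 * aS 2 * g3 2 := by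
  simp only [g1, g2, g3, Fin.isValue, Fin.reduceAdd, zero_add]
  ring

theorem thp_zero_mul_g2_two :
    thp 0 * g2 2 = thp 2 * g2 1 + (aS 1 * th 1 + lam * aP 2) * g3 1
      - (aS 2 * th 2 + lam * aP 0) * g3 2 - aS 2 * aP 2 * aS 0 * g1 2
      + aS 0 * aP 0 * aS 1 * g1 0 := by
  simp only [g1, g2, g3, Fin.isValue, Fin.reduceAdd, zero_add]
  ring

/-- In the localization of `R13` away from θ₁₂ (i.e. `thp 0`), the extension
of `IC2` is generated by the images of the four listed generators:
`θ₃₁θ₁₂ − A₁θ₁² − λA₂₃θ₁ − A₂A₂₃²A₃` (= `g2 0`),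
`θ₁₂θ₂₃ − A₂θ₂² − λA₃₁θ₂ − A₃A₃₁²A₁` (= `g2 1`),
`θ₁θ₂ − A₁₂θ₁₂ − A₂₃A₃A₃₁` (= `g1 0`), and
`θ₃θ₁₂ − A₃₁A₁θ₁ − λA₂₃A₃₁ − A₂A₂₃θ₂` (= `g3 2`).
In particular, on the open set `(θ₁₂ ≠ 0)` the cluster variety is a complete intersection of
codimension 4. -/
theorem IC2_localization_away :
    Ideal.map (algebraMap R13 (Localization.Away (thp 0))) IC2 =
      Ideal.span {algebraMap R13 (Localization.Away (thp 0)) (g2 0),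
        algebraMap R13 (Localization.Away (thp 0)) (g2 1),
        algebraMap R13 (Localization.Away (thp 0)) (g1 0),
        algebraMap R13 (Localization.Away (thp 0)) (g3 2)} := by
  set φ := algebraMap R13 (Localization.Away (thp 0))
  set J := Ideal.span {φ (g2 0), φ (g2 1), φ (g1 0), φ (g3 2)} with hJ
  have h20 : g2 0 ∈ J.comap φ := Ideal.subset_span (by simp)
  have h21 : g2 1 ∈ J.comap φ := Ideal.subset_span (by simp)
  have h10 : g1 0 ∈ J.comap φ := Ideal.subset_span (by simp)
  have h32 : g3 2 ∈ J.comap φ := Ideal.subset_span (by simp)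
  have cancel {x : R13} (h : thp 0 * x ∈ J.comap φ) : x ∈ J.comap φ := Ideal.mem_comap.mpr <|
    Ideal.algebraMap_mem_of_away_mul_mem (Ideal.mem_comap.mp h)
  have h11 : g1 1 ∈ J.comap φ := cancel <| by
    rw [thp_zero_mul_g1_one]
    exact add_mem (sub_mem (Ideal.mul_mem_left _ _ h32) (Ideal.mul_mem_left _ _ h21))
      (Ideal.mul_mem_left _ _ h10)
  have h12 : g1 2 ∈ J.comap φ := cancel <| by
    rw [thp_zero_mul_g1_two]
    exact add_mem (sub_mem (Ideal.mul_mem_left _ _ h32) (Ideal.mul_mem_left _ _ h20))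
      (Ideal.mul_mem_left _ _ h10)
  have h30 : g3 0 ∈ J.comap φ := cancel <| by
    rw [thp_zero_mul_g3_zero]
    exact sub_mem (add_mem (Ideal.mul_mem_left _ _ h21) (Ideal.mul_mem_left _ _ h10))
      (Ideal.mul_mem_left _ _ h32)
  have h31 : g3 1 ∈ J.comap φ := cancel <| by
    rw [thp_zero_mul_g3_one]
    exact sub_mem (add_mem (Ideal.mul_mem_left _ _ h20) (Ideal.mul_mem_left _ _ h10))
      (Ideal.mul_mem_left _ _ h32)
  have h22 : g2 2 ∈ J.comap φ := cancel <| by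
    rw [thp_zero_mul_g2_two]
    exact add_mem (sub_mem (sub_mem (add_mem (Ideal.mul_mem_left _ _ h21)
      (Ideal.mul_mem_left _ _ h31)) (Ideal.mul_mem_left _ _ h32)) (Ideal.mul_mem_left _ _ h12))
      (Ideal.mul_mem_left _ _ h10)
  apply le_antisymm
  · rw [Ideal.map_le_iff_le_comap, IC2, Ideal.span_le]
    rintro _ ((⟨i, rfl⟩ | ⟨i, rfl⟩) | ⟨i, rfl⟩) <;> fin_cases i
    exacts [h10, h11, h12, h20, h21, h22, h30, h31, h32]
  · rw [hJ, Ideal.span_le]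
    rintro _ (rfl | rfl | rfl | rfl) <;>
      exact Ideal.mem_map_of_mem φ (Ideal.subset_span (by simp))
end

section
/- The deep locus X₀ = X_{C₂} ∩ V(θ₁, θ₁₂, θ₂, θ₂₃, θ₃, θ₃₁) ⊆ ℂ¹³ is exactly the union of the following eleven linear subspaces, each contained in the locus where all six cluster coordinates θ₁, θ₁₂, θ₂, θ₂₃, θ₃, θ₃₁ vanish: (a) the one subspace where additionally A₁₂ = A₂₃ = A₃₁ = 0; (b) the three subspaces where additionally A_k = A_{ij} = λ = 0, for (i,j,k) one of the three cyclic permutations of (1,2,3); (c) the six subspaces where additionally A_i = A_{ij} = A_{jk} = 0, for (i,j,k) any of the six permutations of (1,2,3); and (d) the one subspace where additionally A₁ = A₂ = A₃ = λ = 0. -/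
/-!
The C₂ cluster variety.

`R13` is the polynomial ring over ℂ in the 13 variables, indexed as follows:
`0 ↦ θ₁, 1 ↦ θ₁₂, 2 ↦ θ₂, 3 ↦ θ₂₃, 4 ↦ θ₃, 5 ↦ θ₃₁,
 6 ↦ A₁, 7 ↦ A₁₂, 8 ↦ A₂, 9 ↦ A₂₃, 10 ↦ A₃, 11 ↦ A₃₁, 12 ↦ λ`.
Indices `i : Fin 3` stand for the (cyclic) indices 1,2,3, with `Fin 3` addition.
-/

open MvPolynomial

theorem exists_exists_ne_fin_three {q : Fin 3 → Fin 3 → Prop} :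
    (∃ i j, i ≠ j ∧ q i j) ↔ q 0 1 ∨ q 0 2 ∨ q 1 0 ∨ q 1 2 ∨ q 2 0 ∨ q 2 1 := by
  simp [Fin.exists_fin_succ, or_assoc]

/-- Where all cluster coordinates vanish, the nine relations reduce to monomial equations in the
coefficients. -/
theorem mem_XC2_iff_of_thZero {p : Fin 13 → ℂ} (h : thZero p) :
    p ∈ XC2 ↔ ∀ i : Fin 3,
      (eval p (aP (i + 1)) = 0 ∨ eval p (aS (i + 2)) = 0 ∨ eval p (aP (i + 2)) = 0) ∧
      (eval p (aS (i + 1)) = 0 ∨ eval p (aP (i + 1)) = 0 ∨ eval p (aS (i + 2)) = 0) ∧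
      (eval p lam = 0 ∨ eval p (aP (i + 2)) = 0 ∨ eval p (aP i) = 0) := by
  simp [XC2, g1, g2, g3, (h _).1, (h _).2, or_assoc]

/-- The deep locus `X₀ = X_{C₂} ∩ V(θ₁,θ₁₂,θ₂,θ₂₃,θ₃,θ₃₁)` is exactly the
union of eleven linear subspaces, each contained in the locus where all six cluster
coordinates vanish:
(a) the one where additionally `A₁₂ = A₂₃ = A₃₁ = 0`;
(b) the three where additionally `A_k = A_{ij} = λ = 0`, for `(i,j,k)` a cyclic permutation
    of `(1,2,3)`;
(c) the six where additionally `A_i = A_{ij} = A_{jk} = 0`, for `(i,j,k)` any permutation of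
    `(1,2,3)` (here `i,j` distinct determine `k = -(i+j)`);
(d) the one where additionally `A₁ = A₂ = A₃ = λ = 0`. -/
theorem deep_locus_decomposition :
    {p : Fin 13 → ℂ | p ∈ XC2 ∧ thZero p} =
      {p : Fin 13 → ℂ | thZero p ∧ ∀ i : Fin 3, eval p (aP i) = 0} ∪
      (⋃ i : Fin 3, {p : Fin 13 → ℂ | thZero p ∧ eval p (aS (i + 2)) = 0 ∧
        eval p (aP i) = 0 ∧ eval p lam = 0}) ∪
      (⋃ (i : Fin 3) (j : Fin 3) (_ : i ≠ j),
        {p : Fin 13 → ℂ | thZero p ∧ eval p (aS i) = 0 ∧ eval p (aPP i j) = 0 ∧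
          eval p (aPP j (-i - j)) = 0}) ∪
      {p : Fin 13 → ℂ | thZero p ∧ (∀ i : Fin 3, eval p (aS i) = 0) ∧ eval p lam = 0} := by
  ext p
  by_cases h : thZero p
  · simp only [Set.mem_union, Set.mem_iUnion, Set.mem_ofPred_eq, h, true_and,
      mem_XC2_iff_of_thZero h, exists_prop, exists_exists_ne_fin_three, aPP]
    simp only [Fin.forall_fin_succ, Fin.exists_fin_succ]
    simp [show (-2 : Fin 3) = 1 from rfl, show (2 - (-1 - 2) : Fin 3) = 2 from rfl]
    grind (splits := 30)
  · simp [h]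
end

section
/- Let J(p) denote the 9×13 Jacobian matrix of the nine generators of I_{C₂} (partial derivatives with respect to the 13 variables) evaluated at a point p ∈ ℂ¹³. The set of points p ∈ X_{C₂} at which rank J(p) < 4 is exactly the union of the following four linear subspaces, each contained in the locus θ₁ = θ₁₂ = θ₂ = θ₂₃ = θ₃ = θ₃₁ = 0: the subspace where additionally A₁₂ = A₂₃ = A₃₁ = 0, and, for each of the three cyclic permutations (i,j,k) of (1,2,3), the subspace where additionally A_{ij} = A_j = A_k = A_{ki} = λ = 0. In particular X_{C₂} is smooth at every point where some cluster coordinate θᵢ or θ_{ij} is nonzero, and every component of the singular locus has codimension at least 5 in the 9-dimensional variety X_{C₂}. -/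
/-!
The C₂ cluster variety.

`R13` is the polynomial ring over ℂ in the 13 variables, indexed as follows:
`0 ↦ θ₁, 1 ↦ θ₁₂, 2 ↦ θ₂, 3 ↦ θ₂₃, 4 ↦ θ₃, 5 ↦ θ₃₁,
 6 ↦ A₁, 7 ↦ A₁₂, 8 ↦ A₂, 9 ↦ A₂₃, 10 ↦ A₃, 11 ↦ A₃₁, 12 ↦ λ`.
Indices `i : Fin 3` stand for the (cyclic) indices 1,2,3, with `Fin 3` addition.
-/

open MvPolynomial

noncomputable section

/-- The 9×13 Jacobian matrix of the nine generators of `IC2` (rows indexed by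
`Fin 3 × Fin 3` via `genC2`, columns by the 13 variables), evaluated at `p ∈ ℂ¹³`. -/
def JacC2 (p : Fin 13 → ℂ) : Matrix (Fin 3 × Fin 3) (Fin 13) ℂ :=
  Matrix.of fun a b => eval p (pderiv b (genC2 a.1 a.2))

end

/-- The column of `θᵢ`. -/
def colTh : Fin 3 → Fin 13 := ![0, 2, 4]

/-- The column of `θ_{i,i+1}`. -/
def colThp : Fin 3 → Fin 13 := ![1, 3, 5]

/-- The column of `Aᵢ`. -/
def colS : Fin 3 → Fin 13 := ![6, 8, 10]

/-- The column of `A_{i,i+1}`. -/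
def colP : Fin 3 → Fin 13 := ![7, 9, 11]

/-- A lower triangular `4 × 4` submatrix with nonzero diagonal forces rank at least `4`. -/
theorem four_le_rank_of_lowerTriangular {m n K : Type*} [Field K] [Fintype n]
    (M : Matrix m n K) (r : Fin 4 → m) (c : Fin 4 → n)
    (hdiag : M (r 0) (c 0) ≠ 0 ∧ M (r 1) (c 1) ≠ 0 ∧ M (r 2) (c 2) ≠ 0 ∧ M (r 3) (c 3) ≠ 0)
    (hzero : M (r 0) (c 1) = 0 ∧ M (r 0) (c 2) = 0 ∧ M (r 0) (c 3) = 0 ∧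
      M (r 1) (c 2) = 0 ∧ M (r 1) (c 3) = 0 ∧ M (r 2) (c 3) = 0) :
    4 ≤ M.rank := by
  have htri : (M.submatrix r c).IsLowerTriangular := by
    intro i j hij
    replace hij : i < j := hij
    fin_cases i <;> fin_cases j <;> simp_all
  have hdet : (M.submatrix r c).det ≠ 0 := by
    rw [Matrix.det_of_isLowerTriangular _ htri, Fin.prod_univ_four]
    simp [hdiag]
  have hrank := Matrix.rank_of_isUnit (M.submatrix r c)
    ((Matrix.isUnit_iff_isUnit_det _).mpr hdet.isUnit)
  rw [Fintype.card_fin] at hrank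
  exact hrank.symm.le.trans (Matrix.rank_submatrix_le M r c)

/-- The Jacobian has rank at least `4` where some `θᵢ` is nonzero. -/
theorem four_le_rank_of_th_ne_zero (p : Fin 13 → ℂ) (i : Fin 3)
    (h : eval p (th i) ≠ 0) :
    4 ≤ (JacC2 p).rank := by
  apply four_le_rank_of_lowerTriangular _ ![(1, i), (0, i), (0, i + 2), (2, i)]
      ![colS i, colTh (i + 1), colTh (i + 2), colThp (i + 1)] <;>
    fin_cases i <;>
    simp_all [JacC2, genC2, g1, g2, g3, th, thp, aS, aP, lam, colTh, colThp, colS, pderiv_X]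

/-- The Jacobian has rank at least `4` where some `θ_{i,i+1}` is nonzero. -/
theorem four_le_rank_of_thp_ne_zero (p : Fin 13 → ℂ) (i : Fin 3)
    (h : eval p (thp i) ≠ 0) :
    4 ≤ (JacC2 p).rank := by
  apply four_le_rank_of_lowerTriangular _ ![(1, i), (1, i + 1), (0, i), (2, i + 2)]
      ![colThp (i + 2), colThp (i + 1), colP i, colTh (i + 2)] <;>
    fin_cases i <;>
    simp_all [JacC2, genC2, g1, g2, g3, th, thp, aS, aP, lam, colTh, colThp, colP, pderiv_X]

/-- Where `A_{i,i+1} ≠ 0`, the Jacobian has rank at least `4` under the vanishing hypotheses below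
and `λ ≠ 0`. -/
theorem four_le_rank_of_lam_ne_zero (p : Fin 13 → ℂ) (i : Fin 3)
    (ht : thZero p) (hb : eval p (aP i) ≠ 0)
    (hb₁ : eval p (aP (i + 1)) = 0) (hb₂ : eval p (aP (i + 2)) = 0)
    (h : eval p lam ≠ 0) :
    4 ≤ (JacC2 p).rank := by
  apply four_le_rank_of_lowerTriangular _ ![(0, i), (1, i + 2), (2, i), (2, i + 1)]
      ![colThp i, colTh (i + 2), colP (i + 2), colP (i + 1)] <;>
    fin_cases i <;>
    simp_all [JacC2, genC2, g1, g2, g3, thZero, th, thp, aS, aP, lam, colTh, colThp, colP, pderiv_X,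
      Fin.forall_fin_succ]

/-- Where `A_{i,i+1} ≠ 0`, the Jacobian has rank at least `4` under the vanishing hypotheses below
and `A_{i+1} ≠ 0`. -/
theorem four_le_rank_of_aS_succ_ne_zero (p : Fin 13 → ℂ) (i : Fin 3)
    (hb : eval p (aP i) ≠ 0)
    (ha₀ : eval p (aS i) = 0) (hb₁ : eval p (aP (i + 1)) = 0)
    (h : eval p (aS (i + 1)) ≠ 0) :
    4 ≤ (JacC2 p).rank := by
  apply four_le_rank_of_lowerTriangular _ ![(1, i + 2), (2, i), (0, i + 2), (0, i)]
      ![colS i, colTh (i + 1), colP (i + 1), colThp i] <;>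
    fin_cases i <;>
    simp_all [JacC2, genC2, g1, g2, g3, th, thp, aS, aP, lam, colTh, colThp, colS, colP, pderiv_X]

/-- Where `A_{i,i+1} ≠ 0`, the Jacobian has rank at least `4` under the vanishing hypotheses below
and `Aᵢ ≠ 0`. -/
theorem four_le_rank_of_aS_ne_zero (p : Fin 13 → ℂ) (i : Fin 3)
    (hb : eval p (aP i) ≠ 0)
    (ha₁ : eval p (aS (i + 1)) = 0) (hb₂ : eval p (aP (i + 2)) = 0)
    (h : eval p (aS i) ≠ 0) :
    4 ≤ (JacC2 p).rank := by
  apply four_le_rank_of_lowerTriangular _ ![(1, i + 2), (2, i + 1), (0, i + 1), (0, i)]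
      ![colS (i + 1), colTh i, colP (i + 2), colThp i] <;>
    fin_cases i <;>
    simp_all [JacC2, genC2, g1, g2, g3, th, thp, aS, aP, lam, colTh, colThp, colS, colP, pderiv_X]

/-- The Jacobian has rank at least `4` where `A_{i,i+1}` and `A_{i+1,i+2}` are nonzero. -/
theorem four_le_rank_of_aP_succ_ne_zero (p : Fin 13 → ℂ) (i : Fin 3)
    (hb : eval p (aP i) ≠ 0)
    (h : eval p (aP (i + 1)) ≠ 0) :
    4 ≤ (JacC2 p).rank := by
  apply four_le_rank_of_lowerTriangular _ ![(0, i), (0, i + 1), (0, i + 2), (2, i + 1)]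
      ![colThp i, colThp (i + 1), colS (i + 1), 12] <;>
    fin_cases i <;>
    simp_all [JacC2, genC2, g1, g2, g3, th, thp, aS, aP, lam, colThp, colS, pderiv_X]

/-- The Jacobian has rank at least `4` where `A_{i,i+1}` and `A_{i+2,i}` are nonzero. -/
theorem four_le_rank_of_aP_pred_ne_zero (p : Fin 13 → ℂ) (i : Fin 3)
    (hb : eval p (aP i) ≠ 0)
    (h : eval p (aP (i + 2)) ≠ 0) :
    4 ≤ (JacC2 p).rank := by
  apply four_le_rank_of_lowerTriangular _ ![(0, i), (0, i + 2), (0, i + 1), (2, i)]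
      ![colThp i, colThp (i + 2), colS i, 12] <;>
    fin_cases i <;>
    simp_all [JacC2, genC2, g1, g2, g3, th, thp, aS, aP, lam, colThp, colS, pderiv_X]

/-- On `X_{C₂}`, if `θ = 0` and `A_{i,i+1} ≠ 0`, then `Aᵢ A_{i+1} = 0`. -/
theorem aS_mul_aS_succ_eq_zero {p : Fin 13 → ℂ} (hp : p ∈ XC2) (ht : thZero p) {i : Fin 3}
    (hb : eval p (aP i) ≠ 0) :
    eval p (aS i) * eval p (aS (i + 1)) = 0 := by
  have h := (hp (i + 2)).2.1
  fin_cases i <;>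
    simp_all [thZero, g2, th, thp, aS, aP, lam, Fin.forall_fin_succ]

/-- The Jacobian vanishes where `θ = 0` and all `A_{i,i+1}` vanish. -/
theorem JacC2_eq_zero {p : Fin 13 → ℂ} (ht : thZero p) (hb : ∀ i, eval p (aP i) = 0) :
    JacC2 p = 0 := by
  ext ⟨a, i⟩ b
  fin_cases a <;> fin_cases i <;>
    simp_all [JacC2, genC2, g1, g2, g3, thZero, th, thp, aS, aP, lam, pderiv_X,
      Pi.single_apply, Fin.forall_fin_succ, apply_ite (eval p)] <;>
    grind

/-- On the remaining three subspaces the Jacobian has at most one nonzero entry. -/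
theorem JacC2_eq_vecMulVec {p : Fin 13 → ℂ} (ht : thZero p) {i : Fin 3}
    (hb : eval p (aP i) = 0) (ha₁ : eval p (aS (i + 1)) = 0) (ha₂ : eval p (aS (i + 2)) = 0)
    (hb₂ : eval p (aP (i + 2)) = 0) (hl : eval p lam = 0) :
    JacC2 p = Matrix.vecMulVec (Pi.single (0, i + 1) 1)
      (Pi.single (colThp (i + 1)) (-eval p (aP (i + 1)))) := by
  ext ⟨a, j⟩ b
  fin_cases i <;> fin_cases a <;> fin_cases j <;>
    simp_all [Matrix.vecMulVec_apply, JacC2, genC2, g1, g2, g3, thZero, th, thp, aS, aP, lam,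
      colThp, pderiv_X, Pi.single_apply, Fin.forall_fin_succ, apply_ite (eval p)] <;>
    grind

/-- The set of points `p ∈ X_{C₂}` at which the Jacobian matrix of the nine
generators has rank < 4 is exactly the union of four linear subspaces, each contained in the
locus `θ₁ = θ₁₂ = θ₂ = θ₂₃ = θ₃ = θ₃₁ = 0`: the one where additionally
`A₁₂ = A₂₃ = A₃₁ = 0`, and, for each cyclic permutation `(i,j,k)` of `(1,2,3)`, the one where
additionally `A_{ij} = A_j = A_k = A_{ki} = λ = 0`. -/
theorem singular_locus_C2 :
    {p : Fin 13 → ℂ | p ∈ XC2 ∧ (JacC2 p).rank < 4} =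
      {p : Fin 13 → ℂ | thZero p ∧ ∀ i : Fin 3, eval p (aP i) = 0} ∪
      ⋃ i : Fin 3, {p : Fin 13 → ℂ | thZero p ∧ eval p (aP i) = 0 ∧
        eval p (aS (i + 1)) = 0 ∧ eval p (aS (i + 2)) = 0 ∧ eval p (aP (i + 2)) = 0 ∧
        eval p lam = 0} := by
  ext p
  simp only [Set.mem_union, Set.mem_iUnion, Set.mem_ofPred_eq]
  constructor
  · rintro ⟨hp, hr⟩
    have hth (i : Fin 3) : eval p (th i) = 0 := by
      by_contra h
      exact hr.not_ge (four_le_rank_of_th_ne_zero p i h)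
    have hthp (i : Fin 3) : eval p (thp i) = 0 := by
      by_contra h
      exact hr.not_ge (four_le_rank_of_thp_ne_zero p i h)
    have ht : thZero p := fun i => ⟨hth i, hthp i⟩
    by_cases hall : ∀ i, eval p (aP i) = 0
    · exact Or.inl ⟨ht, hall⟩
    obtain ⟨i, hb⟩ := not_forall.mp hall
    have hb₁ : eval p (aP (i + 1)) = 0 := by
      by_contra h
      exact hr.not_ge (four_le_rank_of_aP_succ_ne_zero p i hb h)
    have hb₂ : eval p (aP (i + 2)) = 0 := by
      by_contra h
      exact hr.not_ge (four_le_rank_of_aP_pred_ne_zero p i hb h)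
    have hl : eval p lam = 0 := by
      by_contra h
      exact hr.not_ge (four_le_rank_of_lam_ne_zero p i ht hb hb₁ hb₂ h)
    have haa := aS_mul_aS_succ_eq_zero hp ht hb
    have ha₀ : eval p (aS i) = 0 := by
      by_contra h
      exact hr.not_ge (four_le_rank_of_aS_ne_zero p i hb
        ((mul_eq_zero.mp haa).resolve_left h) hb₂ h)
    have ha₁ : eval p (aS (i + 1)) = 0 := by
      by_contra h
      exact hr.not_ge (four_le_rank_of_aS_succ_ne_zero p i hb ha₀ hb₁ h)
    refine Or.inr ⟨i + 2, ht, hb₂, ?_, ?_, ?_, hl⟩ <;> fin_cases i <;> assumption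
  · rintro (⟨ht, hb⟩ | ⟨i, ht, hb, ha₁, ha₂, hb₂, hl⟩)
    · refine ⟨fun i => ?_, ?_⟩
      · simp [g1, g2, g3, hb, (ht _).1, (ht _).2]
      · rw [JacC2_eq_zero ht hb, Matrix.rank_zero]
        norm_num
    · refine ⟨fun j => ?_, ?_⟩
      · fin_cases i <;> fin_cases j <;>
          simp_all [g1, g2, g3, (ht _).1, (ht _).2]
      · rw [JacC2_eq_vecMulVec ht hb ha₁ ha₂ hb₂ hl]
        exact (Matrix.rank_vecMulVec_le _ _).trans_lt (by norm_num)
end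

section
/- Let σ : R₁₃ → R₁₁ be the ℂ-algebra homomorphism to the polynomial ring R₁₁ = ℂ[θ₁, θ₁₂, θ₂, θ₂₃, θ₃, θ₃₁, A₁₂, A₂, A₂₃, A₃, A₃₁] sending λ to 1, A₁ to 0, and every other variable to the variable of the same name. Then the ideal of R₁₁ generated by the images under σ of the nine generators of I_{C₂} equals the ideal generated by the 2×2 minors of the 3×3 matrix with rows (θ₁₂, A₂θ₂ + A₃₁, A₂A₂₃A₃ + θ₁), (θ₂, θ₂₃, A₃θ₃ + A₁₂), (A₂₃, θ₃, θ₃₁). In particular this specialization of the C₂ cluster variety is a regular pullback from ℙ²×ℙ² format. -/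
/-!
The C₂ cluster variety.

`R13` is the polynomial ring over ℂ in the 13 variables, indexed as follows:
`0 ↦ θ₁, 1 ↦ θ₁₂, 2 ↦ θ₂, 3 ↦ θ₂₃, 4 ↦ θ₃, 5 ↦ θ₃₁,
 6 ↦ A₁, 7 ↦ A₁₂, 8 ↦ A₂, 9 ↦ A₂₃, 10 ↦ A₃, 11 ↦ A₃₁, 12 ↦ λ`.
Indices `i : Fin 3` stand for the (cyclic) indices 1,2,3, with `Fin 3` addition.
-/

open MvPolynomial

noncomputable section

/-- `R11 = ℂ[θ₁, θ₁₂, θ₂, θ₂₃, θ₃, θ₃₁, A₁₂, A₂, A₂₃, A₃, A₃₁]`, indexed as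
`0 ↦ θ₁, 1 ↦ θ₁₂, 2 ↦ θ₂, 3 ↦ θ₂₃, 4 ↦ θ₃, 5 ↦ θ₃₁,
 6 ↦ A₁₂, 7 ↦ A₂, 8 ↦ A₂₃, 9 ↦ A₃, 10 ↦ A₃₁`. -/
abbrev R11 : Type := MvPolynomial (Fin 11) ℂ

/-- The substitution defining `σ : R13 → R11`: it sends `λ` to 1, `A₁` to 0, and every other
variable to the variable of the same name. -/
def subst15 : Fin 13 → R11 :=
  ![X 0, X 1, X 2, X 3, X 4, X 5, 0, X 6, X 7, X 8, X 9, X 10, 1]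

/-- The 3×3 matrix with rows `(θ₁₂, A₂θ₂ + A₃₁, A₂A₂₃A₃ + θ₁)`, `(θ₂, θ₂₃, A₃θ₃ + A₁₂)`,
`(A₂₃, θ₃, θ₃₁)`. -/
def M15 : Matrix (Fin 3) (Fin 3) R11 :=
  !![X 1, X 7 * X 2 + X 10, X 7 * X 8 * X 9 + X 0;
     X 2, X 3, X 9 * X 4 + X 6;
     X 8, X 4, X 5]

end

/-- An ideal containing the 2×2 minors of a matrix with increasing rows and columns contains all
its 2×2 minors. -/
lemma minor_mem_of_lt {R m n : Type*} [CommRing R] [LinearOrder m] [LinearOrder n]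
    (M : Matrix m n R) (I : Ideal R)
    (h : ∀ a c b d, a < c → b < d → M a b * M c d - M a d * M c b ∈ I)
    (a b c d) (hac : a ≠ c) (hbd : b ≠ d) : M a b * M c d - M a d * M c b ∈ I := by
  rcases lt_or_gt_of_ne hac with h₁ | h₁ <;> rcases lt_or_gt_of_ne hbd with h₂ | h₂
  · exact h a c b d h₁ h₂
  · simpa using I.neg_mem (h a c d b h₁ h₂)
  · convert I.neg_mem (h c a b d h₁ h₂) using 1
    ring
  · convert h c a d b h₁ h₂ using 1
    ring

/-- The specialization of `IC2` is contained in `J` if and only if the nine specialized relations lie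
in `J`. -/
lemma map_IC2_le_iff (J : Ideal R11) :
    Ideal.map (aeval subst15 : R13 →ₐ[ℂ] R11) IC2 ≤ J ↔
      ∀ i, aeval subst15 (g1 i) ∈ J ∧ aeval subst15 (g2 i) ∈ J ∧ aeval subst15 (g3 i) ∈ J := by
  simp only [IC2, Ideal.map_le_iff_le_comap, Ideal.span_le, Set.union_subset_iff,
    Set.range_subset_iff, SetLike.mem_coe, Ideal.mem_comap, forall_and, and_assoc]

lemma aeval_g1 : (fun i => aeval subst15 (g1 i)) =
    ![X 0 * X 2 - X 6 * X 1 - X 8 * X 9 * X 10, X 2 * X 4 - X 8 * X 3,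
      X 4 * X 0 - X 10 * X 5 - X 6 * X 7 * X 8] := by
  funext i
  fin_cases i <;> simp [g1, th, thp, aS, aP, subst15]

lemma aeval_g2 : (fun i => aeval subst15 (g2 i)) =
    ![X 5 * X 1 - X 8 * X 0 - X 7 * X 8 ^ 2 * X 9, X 1 * X 3 - X 7 * X 2 ^ 2 - X 10 * X 2,
      X 3 * X 5 - X 9 * X 4 ^ 2 - X 6 * X 4] := by
  funext i
  fin_cases i <;> simp [g2, th, thp, aS, aP, lam, subst15]

lemma aeval_g3 : (fun i => aeval subst15 (g3 i)) =
    ![X 0 * X 3 - X 6 * X 7 * X 2 - X 10 * X 6 - X 9 * X 10 * X 4,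
      X 2 * X 5 - X 8 * X 9 * X 4 - X 6 * X 8, X 4 * X 1 - X 10 * X 8 - X 7 * X 8 * X 2] := by
  funext i
  fin_cases i <;> simp [g3, th, thp, aS, aP, lam, subst15]
  ring

/-- Let `σ : R13 → R11` send `λ` to 1, `A₁` to 0, and every other variable
to the variable of the same name.  Then the ideal of `R11` generated by the images under `σ`
of the nine generators of `IC2` equals the ideal generated by the 2×2 minors of `M15`.  In
particular this specialization of the C₂ cluster variety is a regular pullback from
ℙ²×ℙ² format. -/
theorem C2_specializes_to_P2xP2' :
    Ideal.map (aeval subst15 : R13 →ₐ[ℂ] R11) IC2 =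
      Ideal.span {x : R11 | ∃ a b c d : Fin 3, a ≠ c ∧ b ≠ d ∧
        x = M15 a b * M15 c d - M15 a d * M15 c b} := by
  apply le_antisymm
  · rw [map_IC2_le_iff]
    set J := Ideal.span {x : R11 | ∃ a b c d : Fin 3, a ≠ c ∧ b ≠ d ∧
        x = M15 a b * M15 c d - M15 a d * M15 c b}
    have hJ (a c b d : Fin 3) (hac : a ≠ c) (hbd : b ≠ d) :
        M15 a b * M15 c d - M15 a d * M15 c b ∈ J :=
      Ideal.subset_span ⟨a, b, c, d, hac, hbd, rfl⟩
    have m0101 := hJ 0 1 0 1 (by decide) (by decide)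
    have m0102 := hJ 0 1 0 2 (by decide) (by decide)
    have m0112 := hJ 0 1 1 2 (by decide) (by decide)
    have m0201 := hJ 0 2 0 1 (by decide) (by decide)
    have m0202 := hJ 0 2 0 2 (by decide) (by decide)
    have m0212 := hJ 0 2 1 2 (by decide) (by decide)
    have m1201 := hJ 1 2 0 1 (by decide) (by decide)
    have m1202 := hJ 1 2 0 2 (by decide) (by decide)
    have m1212 := hJ 1 2 1 2 (by decide) (by decide)
    simp only [M15, Matrix.of_apply, Matrix.cons_val] at *
    intro i
    rw [congrFun aeval_g1 i, congrFun aeval_g2 i, congrFun aeval_g3 i]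
    fin_cases i <;> refine ⟨?_, ?_, ?_⟩
    · convert J.sub_mem (J.mul_mem_left (X 9) m0201) m0102 using 1
      simp
      ring
    · convert m0202 using 1
      simp
      ring
    · convert J.sub_mem (J.mul_mem_left (X 7 * X 9) m1201) m0112 using 1
      simp
      ring
    · convert m1201 using 1
      simp
      ring
    · convert m0101 using 1
      simp
      ring
    · convert m1202 using 1
      simp
      ring
    · convert J.sub_mem (J.mul_mem_left (X 7) m1202) m0212 using 1
      simp
      ring
    · convert m1212 using 1
      simp
      ring
    · convert m0201 using 1
      simp
      ring
  · set I := Ideal.map (aeval subst15 : R13 →ₐ[ℂ] R11) IC2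
    have hI := (map_IC2_le_iff I).1 le_rfl
    have h1 (i) : _ ∈ I := congrFun aeval_g1 i ▸ (hI i).1
    have h2 (i) : _ ∈ I := congrFun aeval_g2 i ▸ (hI i).2.1
    have h3 (i) : _ ∈ I := congrFun aeval_g3 i ▸ (hI i).2.2
    rw [Ideal.span_le]
    rintro _ ⟨a, b, c, d, hac, hbd, rfl⟩
    refine minor_mem_of_lt M15 I (fun a c b d hac hbd => ?_) a b c d hac hbd
    fin_cases a <;> fin_cases c <;> try exact absurd hac (by decide)
    all_goals fin_cases b <;> fin_cases d <;> try exact absurd hbd (by decide)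
    · convert h2 1 using 1
      simp [M15]
      ring
    · convert I.sub_mem (I.mul_mem_left (X 9) (h3 2)) (h1 0) using 1
      simp [M15]
      ring
    · convert I.sub_mem (I.mul_mem_left (X 7 * X 9) (h1 1)) (h3 0) using 1
      simp [M15]
      ring
    · convert h3 2 using 1
      simp [M15]
      ring
    · convert h2 0 using 1
      simp [M15]
      ring
    · convert I.sub_mem (I.mul_mem_left (X 7) (h3 1)) (h1 2) using 1
      simp [M15]
      ring
    · convert h1 1 using 1
      simp [M15]
      ring
    · convert h3 1 using 1
      simp [M15]
      ring
    · convert h2 2 using 1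
      simp [M15]
      ring
end

section
/- Let σ : R₁₃ → R₁₂ be the ℂ-algebra homomorphism to the polynomial ring R₁₂ = ℂ[θ₁, θ₁₂, θ₂, θ₂₃, θ₃, θ₃₁, A₁, A₂, A₂₃, A₃, A₃₁, λ] sending A₁₂ to 1 and every other variable to the variable of the same name. Then the ideal of R₁₂ generated by the images under σ of the nine generators of I_{C₂} equals the ideal generated by the five 4×4 Pfaffians of the 5×5 skew-symmetric matrix M with strict upper-triangular entries M₁₂ = A₁, M₁₃ = θ₂, M₁₄ = θ₂₃, M₁₅ = A₃θ₃ + λ, M₂₃ = A₂₃, M₂₄ = θ₃, M₂₅ = θ₃₁, M₃₄ = A₃₁, M₃₅ = θ₁, M₄₅ = A₂, together with the element θ₁₂ − θ₁θ₂ + A₂₃A₃A₃₁. In particular, the specialization A₁₂ = 1 of the C₂ cluster variety is a hypersurface inside Gr(2,5) Pfaffian format. -/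
/-!
The C₂ cluster variety.

`R13` is the polynomial ring over ℂ in the 13 variables, indexed as follows:
`0 ↦ θ₁, 1 ↦ θ₁₂, 2 ↦ θ₂, 3 ↦ θ₂₃, 4 ↦ θ₃, 5 ↦ θ₃₁,
 6 ↦ A₁, 7 ↦ A₁₂, 8 ↦ A₂, 9 ↦ A₂₃, 10 ↦ A₃, 11 ↦ A₃₁, 12 ↦ λ`.
Indices `i : Fin 3` stand for the (cyclic) indices 1,2,3, with `Fin 3` addition.
-/

open MvPolynomial

noncomputable section

/-- `R12 = ℂ[θ₁, θ₁₂, θ₂, θ₂₃, θ₃, θ₃₁, A₁, A₂, A₂₃, A₃, A₃₁, λ]`, indexed as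
`0 ↦ θ₁, 1 ↦ θ₁₂, 2 ↦ θ₂, 3 ↦ θ₂₃, 4 ↦ θ₃, 5 ↦ θ₃₁,
 6 ↦ A₁, 7 ↦ A₂, 8 ↦ A₂₃, 9 ↦ A₃, 10 ↦ A₃₁, 11 ↦ λ`. -/
abbrev R12 : Type := MvPolynomial (Fin 12) ℂ

/-- The substitution defining `σ : R13 → R12`: it sends `A₁₂` to 1 and every other variable
to the variable of the same name. -/
def subst16 : Fin 13 → R12 :=
  ![X 0, X 1, X 2, X 3, X 4, X 5, X 6, 1, X 7, X 8, X 9, X 10, X 11]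

/- The strict upper-triangular entries of the 5×5 skew-symmetric matrix `M`:
`M₁₂ = A₁`, `M₁₃ = θ₂`, `M₁₄ = θ₂₃`, `M₁₅ = A₃θ₃ + λ`, `M₂₃ = A₂₃`, `M₂₄ = θ₃`, `M₂₅ = θ₃₁`,
`M₃₄ = A₃₁`, `M₃₅ = θ₁`, `M₄₅ = A₂`. -/
def m12 : R12 := X 6
def m13 : R12 := X 2
def m14 : R12 := X 3
def m15 : R12 := X 9 * X 4 + X 11
def m23 : R12 := X 8
def m24 : R12 := X 4
def m25 : R12 := X 5
def m34 : R12 := X 10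
def m35 : R12 := X 0
def m45 : R12 := X 7

/-- The 4×4 Pfaffian of `M` deleting row and column 1. -/
def pf1 : R12 := m23 * m45 - m24 * m35 + m25 * m34
/-- The 4×4 Pfaffian of `M` deleting row and column 2. -/
def pf2 : R12 := m13 * m45 - m14 * m35 + m15 * m34
/-- The 4×4 Pfaffian of `M` deleting row and column 3. -/
def pf3 : R12 := m12 * m45 - m14 * m25 + m15 * m24
/-- The 4×4 Pfaffian of `M` deleting row and column 4. -/
def pf4 : R12 := m12 * m35 - m13 * m25 + m15 * m23
/-- The 4×4 Pfaffian of `M` deleting row and column 5. -/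
def pf5 : R12 := m12 * m34 - m13 * m24 + m14 * m23

/-- The extra hypersurface element `θ₁₂ − θ₁θ₂ + A₂₃A₃A₃₁`. -/
def extra16 : R12 := X 1 - X 0 * X 2 + X 8 * X 9 * X 10

end

/-- The first family of relations specializes at `A₁₂ = 1` to Pfaffians and the extra element. -/
theorem aeval_subst16_g1 : ∀ i : Fin 3,
    aeval subst16 (g1 i) = (![-extra16, -pf5, -pf1] : Fin 3 → R12) i := by
  intro i
  fin_cases i <;>
    simp [g1, th, thp, aS, aP, subst16, extra16, pf5, pf1, m12, m13, m14, m23, m24, m25,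
      m34, m35, m45] <;> ring

/-- The second family of relations at `A₁₂ = 1`, as combinations of Pfaffians and the extra
element. -/
theorem aeval_subst16_g2 : ∀ i : Fin 3,
    aeval subst16 (g2 i) =
      (![X 5 * extra16 - X 0 * pf4 - X 9 * X 8 * pf1,
        X 3 * extra16 - X 2 * pf2 - X 9 * X 10 * pf5, -pf3] : Fin 3 → R12) i := by
  intro i
  fin_cases i <;>
    simp [g2, th, thp, aS, aP, lam, subst16, extra16, pf1, pf2, pf3, pf4, pf5, m12, m13, m14,
      m15, m23, m24, m25, m34, m35, m45] <;> ring

/-- The third family of relations at `A₁₂ = 1`, as combinations of Pfaffians and the extra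
element. -/
theorem aeval_subst16_g3 : ∀ i : Fin 3,
    aeval subst16 (g3 i) =
      (![-pf2, -pf4, X 4 * extra16 - X 10 * pf4 - X 2 * pf1] : Fin 3 → R12) i := by
  intro i
  fin_cases i <;>
    simp [g3, th, thp, aS, aP, lam, subst16, extra16, pf1, pf2, pf4, m12, m13, m14, m15,
      m23, m24, m25, m34, m35, m45] <;> ring

/-- Let `σ : R13 → R12` send `A₁₂` to 1 and every other variable to the
variable of the same name.  Then the ideal of `R12` generated by the images under `σ` of the
nine generators of `IC2` equals the ideal generated by the five 4×4 Pfaffians of the 5×5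
skew-symmetric matrix `M` together with the element `θ₁₂ − θ₁θ₂ + A₂₃A₃A₃₁`.  In particular
the specialization `A₁₂ = 1` of the C₂ cluster variety is a hypersurface inside Gr(2,5)
Pfaffian format. -/
theorem C2_specializes_to_A2_plus_CI :
    Ideal.map (aeval subst16 : R13 →ₐ[ℂ] R12) IC2 =
      Ideal.span {pf1, pf2, pf3, pf4, pf5, extra16} := by
  set J : Ideal R12 := Ideal.span {pf1, pf2, pf3, pf4, pf5, extra16} with hJ
  have h1 : pf1 ∈ J := Ideal.subset_span (by simp)
  have h2 : pf2 ∈ J := Ideal.subset_span (by simp)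
  have h3 : pf3 ∈ J := Ideal.subset_span (by simp)
  have h4 : pf4 ∈ J := Ideal.subset_span (by simp)
  have h5 : pf5 ∈ J := Ideal.subset_span (by simp)
  have he : extra16 ∈ J := Ideal.subset_span (by simp)
  apply le_antisymm
  · rw [IC2, Ideal.map_span, Ideal.span_le]
    rintro _ ⟨_, (⟨i, rfl⟩ | ⟨i, rfl⟩) | ⟨i, rfl⟩, rfl⟩
    · rw [SetLike.mem_coe, aeval_subst16_g1]
      fin_cases i
      exacts [J.neg_mem he, J.neg_mem h5, J.neg_mem h1]
    · rw [SetLike.mem_coe, aeval_subst16_g2]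
      fin_cases i
      exacts [J.sub_mem (J.sub_mem (J.mul_mem_left _ he) (J.mul_mem_left _ h4))
          (J.mul_mem_left _ h1),
        J.sub_mem (J.sub_mem (J.mul_mem_left _ he) (J.mul_mem_left _ h2))
          (J.mul_mem_left _ h5),
        J.neg_mem h3]
    · rw [SetLike.mem_coe, aeval_subst16_g3]
      fin_cases i
      exacts [J.neg_mem h2, J.neg_mem h4,
        J.sub_mem (J.sub_mem (J.mul_mem_left _ he) (J.mul_mem_left _ h4))
          (J.mul_mem_left _ h1)]
  · have k1 (i : Fin 3) := Ideal.mem_map_of_mem (aeval subst16 : R13 →ₐ[ℂ] R12)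
      (show g1 i ∈ IC2 from Ideal.subset_span (.inl (.inl ⟨i, rfl⟩)))
    have k2 (i : Fin 3) := Ideal.mem_map_of_mem (aeval subst16 : R13 →ₐ[ℂ] R12)
      (show g2 i ∈ IC2 from Ideal.subset_span (.inl (.inr ⟨i, rfl⟩)))
    have k3 (i : Fin 3) := Ideal.mem_map_of_mem (aeval subst16 : R13 →ₐ[ℂ] R12)
      (show g3 i ∈ IC2 from Ideal.subset_span (.inr ⟨i, rfl⟩))
    simp only [aeval_subst16_g1] at k1
    simp only [aeval_subst16_g2] at k2
    simp only [aeval_subst16_g3] at k3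
    rw [hJ, Ideal.span_le]
    rintro _ (rfl | rfl | rfl | rfl | rfl | rfl)
    exacts [neg_mem_iff.1 (k1 2), neg_mem_iff.1 (k3 0), neg_mem_iff.1 (k2 2),
      neg_mem_iff.1 (k3 1), neg_mem_iff.1 (k1 1), neg_mem_iff.1 (k1 0)]
end

section
/- Let ι : ℂ[θ₁, θ₂, θ₃, A₁, A₁₂, A₂, A₂₃, A₃, A₃₁, λ] → R₁₃ be the inclusion of polynomial rings induced by the inclusion of these 10 variables among the 13. Then the preimage ideal ι⁻¹(I_{C₂}) (the elimination ideal of I_{C₂} with respect to the variables θ₁₂, θ₂₃, θ₃₁) is the principal ideal generated by θ₁θ₂θ₃ − A₃₁A₁A₁₂θ₁ − A₁₂A₂A₂₃θ₂ − A₂₃A₃A₃₁θ₃ − λA₁₂A₂₃A₃₁. In other words, the Gorenstein projection of X_{C₂} eliminating θ₁₂, θ₂₃, θ₃₁ is the hypersurface θ₁θ₂θ₃ = A₃₁A₁A₁₂θ₁ + A₁₂A₂A₂₃θ₂ + A₂₃A₃A₃₁θ₃ + λA₁₂A₂₃A₃₁. -/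
/-!
The C₂ cluster variety.

`R13` is the polynomial ring over ℂ in the 13 variables, indexed as follows:
`0 ↦ θ₁, 1 ↦ θ₁₂, 2 ↦ θ₂, 3 ↦ θ₂₃, 4 ↦ θ₃, 5 ↦ θ₃₁,
 6 ↦ A₁, 7 ↦ A₁₂, 8 ↦ A₂, 9 ↦ A₂₃, 10 ↦ A₃, 11 ↦ A₃₁, 12 ↦ λ`.
Indices `i : Fin 3` stand for the (cyclic) indices 1,2,3, with `Fin 3` addition.
-/

open MvPolynomial

noncomputable section

/-- `R10 = ℂ[θ₁, θ₂, θ₃, A₁, A₁₂, A₂, A₂₃, A₃, A₃₁, λ]`, indexed as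
`0 ↦ θ₁, 1 ↦ θ₂, 2 ↦ θ₃, 3 ↦ A₁, 4 ↦ A₁₂, 5 ↦ A₂, 6 ↦ A₂₃, 7 ↦ A₃, 8 ↦ A₃₁, 9 ↦ λ`. -/
abbrev R10 : Type := MvPolynomial (Fin 10) ℂ

/-- The inclusion of the 10 variables `θ₁, θ₂, θ₃, A₁, A₁₂, A₂, A₂₃, A₃, A₃₁, λ` among the
13 variables of `R13`. -/
def emb17 : Fin 10 → Fin 13 := ![0, 2, 4, 6, 7, 8, 9, 10, 11, 12]

/-- The cubic hypersurface `θ₁θ₂θ₃ − A₃₁A₁A₁₂θ₁ − A₁₂A₂A₂₃θ₂ − A₂₃A₃A₃₁θ₃ − λA₁₂A₂₃A₃₁`. -/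
def cubic17 : R10 :=
  X 0 * X 1 * X 2 - X 8 * X 3 * X 4 * X 0 - X 4 * X 5 * X 6 * X 1
    - X 6 * X 7 * X 8 * X 2 - X 9 * X 4 * X 6 * X 8

end

theorem C2_relations_of_cubic {Q : Type*} [CommRing Q]
    {x y z r s t A B C a b c l : Q} (ha : IsUnit a) (hb : IsUnit b) (hc : IsUnit c)
    (hr : a * r = x * y - b * C * c) (hs : b * s = y * z - c * A * a)
    (ht : c * t = z * x - a * B * b)
    (hF : x * y * z - c * A * a * x - a * B * b * y - b * C * c * z - l * a * b * c = 0) :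
    x * y - a * r - b * C * c = 0 ∧
      t * r - A * x ^ 2 - l * b * x - B * b ^ 2 * C = 0 ∧
      x * s - a * B * y - l * c * a - C * c * z = 0 := by
  refine ⟨by linear_combination -hr, ?_, ?_⟩
  · refine (ha.mul hc).mul_right_eq_zero.mp ?_
    linear_combination (c * t) * hr + (x * y - b * C * c) * ht + x * hF
  · refine hb.mul_right_eq_zero.mp ?_
    linear_combination x * hs + hF

theorem cubic17_mem_IC2 : (rename emb17 : R10 →ₐ[ℂ] R13) cubic17 ∈ IC2 := by
  have h : (rename emb17 : R10 →ₐ[ℂ] R13) cubic17 = th 2 * g1 0 + aP 0 * g3 2 := by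
    simp [cubic17, emb17, g1, g3, th, thp, aS, aP, lam]
    ring
  rw [h]
  refine IC2.add_mem (IC2.mul_mem_left _ (Ideal.subset_span ?_))
    (IC2.mul_mem_left _ (Ideal.subset_span ?_))
  · exact Or.inl (Or.inl ⟨0, rfl⟩)
  · exact Or.inr ⟨2, rfl⟩

/-- If `A₁₂`, `A₂₃`, `A₃₁` become units and the cubic becomes zero in a ring `Q`, then the map
from `R10` to `Q` extends over `R13 / IC2`, so it kills the elimination ideal. -/
theorem map_eq_zero_of_rename_mem_IC2 {Q : Type*} [CommRing Q] [Algebra ℂ Q]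
    (φ : R10 →ₐ[ℂ] Q) (ha : IsUnit (φ (X 4))) (hb : IsUnit (φ (X 6))) (hc : IsUnit (φ (X 8)))
    (hF : φ cubic17 = 0) {f : R10} (hf : (rename emb17 : R10 →ₐ[ℂ] R13) f ∈ IC2) :
    φ f = 0 := by
  obtain ⟨r, hr⟩ := ha.dvd (a := φ (X 0) * φ (X 1) - φ (X 6) * φ (X 7) * φ (X 8))
  obtain ⟨s, hs⟩ := hb.dvd (a := φ (X 1) * φ (X 2) - φ (X 8) * φ (X 3) * φ (X 4))
  obtain ⟨t, ht⟩ := hc.dvd (a := φ (X 2) * φ (X 0) - φ (X 4) * φ (X 5) * φ (X 6))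
  simp only [cubic17, map_sub, map_mul] at hF
  obtain ⟨h10, h20, h30⟩ := C2_relations_of_cubic ha hb hc hr.symm hs.symm ht.symm hF
  obtain ⟨h11, h21, h31⟩ := C2_relations_of_cubic (l := φ (X 9)) hb hc ha hs.symm ht.symm hr.symm
    (by linear_combination hF)
  obtain ⟨h12, h22, h32⟩ := C2_relations_of_cubic (l := φ (X 9)) hc ha hb ht.symm hr.symm hs.symm
    (by linear_combination hF)
  let ψ : R13 →ₐ[ℂ] Q := aeval ![φ (X 0), r, φ (X 1), s, φ (X 2), t, φ (X 3), φ (X 4), φ (X 5),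
    φ (X 6), φ (X 7), φ (X 8), φ (X 9)]
  have hψ : IC2 ≤ RingHom.ker ψ := by
    refine Ideal.span_le.mpr ?_
    rintro _ ((⟨i, rfl⟩ | ⟨i, rfl⟩) | ⟨i, rfl⟩) <;>
      rw [SetLike.mem_coe, RingHom.mem_ker] <;> fin_cases i
    · simpa [ψ, g1, th, thp, aS, aP] using h10
    · simpa [ψ, g1, th, thp, aS, aP] using h11
    · simpa [ψ, g1, th, thp, aS, aP] using h12
    · simpa [ψ, g2, th, thp, aS, aP, lam] using h20
    · simpa [ψ, g2, th, thp, aS, aP, lam] using h21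
    · simpa [ψ, g2, th, thp, aS, aP, lam] using h22
    · simpa [ψ, g3, th, thp, aS, aP, lam] using h30
    · simpa [ψ, g3, th, thp, aS, aP, lam] using h31
    · simpa [ψ, g3, th, thp, aS, aP, lam] using h32
  have hcomp : ψ.comp (rename emb17) = φ := by
    ext i
    fin_cases i <;> simp [ψ, emb17]
  rw [← hcomp]
  exact hψ hf

theorem Prime.dvd_of_dvd_pow_mul {R : Type*} [CommRing R] [IsDomain R] {p F f : R}
    (hp : Prime p) (hpF : ¬ p ∣ F) (n : ℕ) (h : F ∣ p ^ n * f) : F ∣ f := by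
  induction n with
  | zero => simpa using h
  | succ n ih =>
    refine ih ?_
    obtain ⟨g, hg⟩ := h
    obtain ⟨k, rfl⟩ := (hp.dvd_or_dvd (Dvd.intro (p ^ n * f) (by rw [← hg]; ring))).resolve_left hpF
    exact ⟨k, mul_left_cancel₀ hp.ne_zero (by linear_combination hg)⟩

theorem X_not_dvd_cubic17 {i : Fin 10} (hi : i = 4 ∨ i = 6 ∨ i = 8) :
    ¬ (X i : R10) ∣ cubic17 := by
  intro h
  have h' := map_dvd (eval (![1, 1, 1, 0, 0, 0, 0, 0, 0, 0] : Fin 10 → ℂ)) h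
  rcases hi with rfl | rfl | rfl <;> simp [cubic17] at h'

theorem cubic17_dvd_of_rename_mem_IC2 {f : R10}
    (hf : (rename emb17 : R10 →ₐ[ℂ] R13) f ∈ IC2) : cubic17 ∣ f := by
  let q := Ideal.Quotient.mkₐ ℂ (Ideal.span {cubic17})
  let u := q (X 4 * X 6 * X 8)
  let Q := Localization.Away u
  let φ : R10 →ₐ[ℂ] Q := (IsScalarTower.toAlgHom ℂ (R10 ⧸ Ideal.span {cubic17}) Q).comp q
  have hu : IsUnit (φ (X 4) * φ (X 6) * φ (X 8)) := by
    rw [← map_mul, ← map_mul]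
    exact IsLocalization.Away.algebraMap_isUnit u
  have hF : φ cubic17 = 0 := by
    have : q cubic17 = 0 := Ideal.Quotient.eq_zero_iff_mem.mpr (Ideal.mem_span_singleton_self _)
    simp [φ, this]
  have h0 : algebraMap _ Q (q f) = 0 :=
    map_eq_zero_of_rename_mem_IC2 φ
      (isUnit_of_mul_isUnit_left (isUnit_of_mul_isUnit_left hu))
      (isUnit_of_mul_isUnit_right (isUnit_of_mul_isUnit_left hu))
      (isUnit_of_mul_isUnit_right hu) hF hf
  obtain ⟨⟨_, n, rfl⟩, hn⟩ := (IsLocalization.map_eq_zero_iff (Submonoid.powers u) Q _).mp h0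
  have hd : cubic17 ∣ X 4 ^ n * (X 6 ^ n * (X 8 ^ n * f)) := by
    rw [← Ideal.mem_span_singleton, ← Ideal.Quotient.eq_zero_iff_mem]
    change q _ = 0
    rw [← hn]
    simp only [u, map_mul, map_pow]
    ring
  refine (X_prime (i := 8)).dvd_of_dvd_pow_mul (X_not_dvd_cubic17 (by simp)) n ?_
  refine (X_prime (i := 6)).dvd_of_dvd_pow_mul (X_not_dvd_cubic17 (by simp)) n ?_
  exact (X_prime (i := 4)).dvd_of_dvd_pow_mul (X_not_dvd_cubic17 (by simp)) n hd

/-- Let `ι : R10 → R13` be the inclusion of polynomial rings induced by the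
inclusion of the 10 variables `θ₁, θ₂, θ₃, A₁, A₁₂, A₂, A₂₃, A₃, A₃₁, λ` among the 13.  Then
the elimination ideal `ι⁻¹(IC2)` is the principal ideal generated by
`θ₁θ₂θ₃ − A₃₁A₁A₁₂θ₁ − A₁₂A₂A₂₃θ₂ − A₂₃A₃A₃₁θ₃ − λA₁₂A₂₃A₃₁`: the Gorenstein projection of
`X_{C₂}` eliminating `θ₁₂, θ₂₃, θ₃₁` is this cubic hypersurface. -/
theorem C2_projection_hypersurface :
    Ideal.comap (MvPolynomial.rename emb17 : R10 →ₐ[ℂ] R13) IC2 =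
      Ideal.span {cubic17} := by
  refine le_antisymm (fun f hf => ?_) ?_
  · exact Ideal.mem_span_singleton.mpr (cubic17_dvd_of_rename_mem_IC2 hf)
  · rw [Ideal.span_singleton_le_iff_mem]
    exact cubic17_mem_IC2
end
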